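/- arXiv:2205.00987 — 3 statements merged into one kernel-verified Lean document; each statement's English description precedes it below -/
import Mathlib

section
/- Let q be an odd prime power, let G = GL_n(𝔽_q), and let A ∈ G be such that conjugation by A is an involution of G (i.e. A² is a scalar matrix). Let H_A be the centralizer of A in G. If π is a cuspidal irreducible complex representation of G that has a nonzero H_A-invariant vector, then π is isomorphic to its dual representation π*. -/
open Matrix

noncomputable section

namespace Paper

/-- nonzero vector invariant under a set of group elements -/
def HasInvVec {G V : Type*} [Group G] [AddCommGroup V] [Module ℂ V]
    (π : Representation ℂ G V) (S : Set G) : Prop :=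
  ∃ v : V, v ≠ 0 ∧ ∀ g ∈ S, π g v = v

/-- nonzero invariant linear functional -/
def HasInvFunctional {G V : Type*} [Group G] [AddCommGroup V] [Module ℂ V]
    (π : Representation ℂ G V) (S : Set G) : Prop :=
  ∃ ℓ : Module.Dual ℂ V, ℓ ≠ 0 ∧ ∀ g ∈ S, ∀ v : V, ℓ (π g v) = ℓ v

/-- isomorphism of representations -/
def RepIso {G V W : Type*} [Group G] [AddCommGroup V] [Module ℂ V] [AddCommGroup W] [Module ℂ W]
    (π : Representation ℂ G V) (π' : Representation ℂ G W) : Prop :=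
  ∃ e : V ≃ₗ[ℂ] W, ∀ (g : G) (v : V), e (π g v) = π' g (e v)

/-- irreducibility -/
def IsIrred {G V : Type*} [Group G] [AddCommGroup V] [Module ℂ V]
    (π : Representation ℂ G V) : Prop :=
  (∃ v : V, v ≠ 0) ∧
    ∀ W : Submodule ℂ V, (∀ (g : G), ∀ v ∈ W, π g v ∈ W) → W = ⊥ ∨ W = ⊤

/-- membership in the "unipotent radical" pattern for the partition function `f`:
the matrix agrees with the identity except at entries `(i,j)` with `f i < f j`. -/
def unipMem {F : Type*} [Field F] {n m : ℕ} (f : Fin n → Fin m)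
    (A : Matrix (Fin n) (Fin n) F) : Prop :=
  ∀ i j, ¬ f i < f j → A i j = (1 : Matrix (Fin n) (Fin n) F) i j

/-- a representation of `GL_n(F)` is cuspidal if for every proper standard parabolic
(given by a monotone surjection onto `Fin m`, `m ≥ 2`), the only vector invariant under the
corresponding unipotent radical is zero. -/
def IsCuspidal {F : Type*} [Field F] {n : ℕ} {V : Type*} [AddCommGroup V] [Module ℂ V]
    (π : Representation ℂ (GL (Fin n) F) V) : Prop :=
  ∀ (m : ℕ) (f : Fin n → Fin m), 2 ≤ m → Monotone f → Function.Surjective f →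
    ∀ v : V, (∀ A : GL (Fin n) F, unipMem f (A : Matrix (Fin n) (Fin n) F) → π A v = v) → v = 0

/-- the standard parabolic subgroup attached to a partition function `f` (block
upper-triangular invertible matrices). -/
def parabolic {F : Type*} [Field F] {n m : ℕ} (f : Fin n → Fin m) : Subgroup (GL (Fin n) F) where
  carrier := {A | BlockTriangular (A : Matrix (Fin n) (Fin n) F) f}
  one_mem' := by simpa using blockTriangular_one
  mul_mem' := fun ha hb => by simpa using Matrix.BlockTriangular.mul ha hb
  inv_mem' := by
    intro A hA
    have h : ((A⁻¹ : GL (Fin n) F) : Matrix (Fin n) (Fin n) F)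
        = ((A : Matrix (Fin n) (Fin n) F))⁻¹ := by
      simp [Matrix.coe_units_inv]
    simp only [Set.mem_setOf_eq] at hA ⊢
    rw [h]
    haveI : Invertible (A : Matrix (Fin n) (Fin n) F) := A.invertible
    exact blockTriangular_inv_of_blockTriangular hA


variable {F : Type*} [Field F] {n m k : ℕ}

def leviMem {α : Type*} (f : Fin n → α) (A : Matrix (Fin n) (Fin n) F) : Prop :=
  ∀ i j, f i ≠ f j → A i j = 0

/-- the standard Levi subgroup attached to a partition function `f`
(block-diagonal invertible matrices). -/
def levi (f : Fin n → Fin m) : Subgroup (GL (Fin n) F) where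
  carrier := {A | leviMem f (A : Matrix (Fin n) (Fin n) F)}
  one_mem' := by
    intro i j hij
    have : i ≠ j := fun h => hij (by rw [h])
    simp [Matrix.one_apply, this]
  mul_mem' := by
    intro A B hA hB
    intro i j hij
    show (((A : Matrix (Fin n) (Fin n) F)) * B) i j = 0
    rw [Matrix.mul_apply]
    apply Finset.sum_eq_zero
    intro x _
    by_cases h : f i = f x
    · rw [hB x j (by rw [← h]; exact hij), mul_zero]
    · rw [hA i x h, zero_mul]
  inv_mem' := by
    intro A hA
    simp only [Set.mem_setOf_eq] at hA ⊢
    haveI : Invertible (A : Matrix (Fin n) (Fin n) F) := A.invertible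
    have h1 : BlockTriangular (A : Matrix (Fin n) (Fin n) F) f := fun i j h => hA i j (ne_of_gt h)
    have h2 : BlockTriangular ((A : Matrix (Fin n) (Fin n) F))ᵀ f :=
      fun i j h => hA j i (ne_of_lt h)
    have h1' := blockTriangular_inv_of_blockTriangular h1
    haveI : Invertible ((A : Matrix (Fin n) (Fin n) F))ᵀ := Matrix.invertibleTranspose _
    have h2' := blockTriangular_inv_of_blockTriangular h2
    have hcoe : ((A⁻¹ : GL (Fin n) F) : Matrix (Fin n) (Fin n) F)
        = ((A : Matrix (Fin n) (Fin n) F))⁻¹ := by simp [Matrix.coe_units_inv]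
    rw [hcoe]
    intro i j hij
    rcases lt_or_gt_of_ne hij with h | h
    · have := h2' h
      rw [← Matrix.transpose_nonsing_inv] at this
      simpa using this
    · exact h1' h

theorem submatrix_mul_block (f : Fin n → Fin m) (a : Fin m) (e : Fin k → Fin n)
    (he : Function.Injective e) (hmem : ∀ i, f (e i) = a)
    (hsurj : ∀ j, f j = a → ∃ i, e i = j)
    {A B : Matrix (Fin n) (Fin n) F} (hA : BlockTriangular A f) (hB : BlockTriangular B f) :
    (A * B).submatrix e e = A.submatrix e e * B.submatrix e e := by
  ext i j
  rw [Matrix.submatrix_apply, Matrix.mul_apply, Matrix.mul_apply]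
  rw [show (∑ x : Fin n, A (e i) x * B x (e j))
      = ∑ x ∈ Finset.univ.image e, A (e i) x * B x (e j) from ?_]
  · rw [Finset.sum_image (fun x _ y _ h => he h)]
    simp
  · symm
    apply Finset.sum_subset (Finset.subset_univ _)
    intro x _ hx
    have hxa : f x ≠ a := by
      intro hfa
      obtain ⟨i', hi'⟩ := hsurj x hfa
      exact hx (Finset.mem_image.mpr ⟨i', Finset.mem_univ _, hi'⟩)
    rcases lt_or_gt_of_ne hxa with h | h
    · rw [hA (show f x < f (e i) by rw [hmem]; exact h), zero_mul]
    · rw [hB (show f (e j) < f x by rw [hmem]; exact h), mul_zero]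


theorem parabolic_mem' {F : Type*} [Field F] {n m : ℕ} {f : Fin n → Fin m} {A : GL (Fin n) F} :
    A ∈ parabolic f ↔ BlockTriangular (A : Matrix (Fin n) (Fin n) F) f := Iff.rfl

theorem levi_mem' {F : Type*} [Field F] {n m : ℕ} {f : Fin n → Fin m} {A : GL (Fin n) F} :
    A ∈ levi f ↔ leviMem f (A : Matrix (Fin n) (Fin n) F) := Iff.rfl

/-- extraction of the `a`-th diagonal block, as a group homomorphism from the parabolic
subgroup to a general linear group, along an enumeration `e` of the `a`-th block. -/
def leviProj (f : Fin n → Fin m) (a : Fin m) (e : Fin k → Fin n)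
    (he : Function.Injective e) (hmem : ∀ i, f (e i) = a)
    (hsurj : ∀ j, f j = a → ∃ i, e i = j) :
    (parabolic (F := F) f) →* GL (Fin k) F where
  toFun A :=
    { val := ((A : GL (Fin n) F) : Matrix (Fin n) (Fin n) F).submatrix e e
      inv := (((A : GL (Fin n) F)⁻¹ : GL (Fin n) F) : Matrix (Fin n) (Fin n) F).submatrix e e
      val_inv := by
        rw [← submatrix_mul_block f a e he hmem hsurj (parabolic_mem'.mp A.2)
          (parabolic_mem'.mp ((parabolic f).inv_mem A.2))]
        rw [show ((A : GL (Fin n) F) : Matrix (Fin n) (Fin n) F) *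
            (((A : GL (Fin n) F)⁻¹ : GL (Fin n) F) : Matrix (Fin n) (Fin n) F) = 1 by
          rw [← Units.val_mul, mul_inv_cancel, Units.val_one]]
        exact Matrix.submatrix_one e he
      inv_val := by
        rw [← submatrix_mul_block f a e he hmem hsurj
          (parabolic_mem'.mp ((parabolic f).inv_mem A.2)) (parabolic_mem'.mp A.2)]
        rw [show (((A : GL (Fin n) F)⁻¹ : GL (Fin n) F) : Matrix (Fin n) (Fin n) F) *
            ((A : GL (Fin n) F) : Matrix (Fin n) (Fin n) F) = 1 by
          rw [← Units.val_mul, inv_mul_cancel, Units.val_one]]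
        exact Matrix.submatrix_one e he }
  map_one' := by
    ext i j
    show ((1 : Matrix (Fin n) (Fin n) F).submatrix e e) i j = _
    rw [Matrix.submatrix_one e he]
    rfl
  map_mul' A B := by
    ext i j
    show ((((A * B : (parabolic f)) : GL (Fin n) F) : Matrix (Fin n) (Fin n) F).submatrix e e) i j
      = _
    rw [show (((A * B : (parabolic f)) : GL (Fin n) F) : Matrix (Fin n) (Fin n) F)
        = ((A : GL (Fin n) F) : Matrix (Fin n) (Fin n) F) *
          ((B : GL (Fin n) F) : Matrix (Fin n) (Fin n) F) from rfl]
    rw [submatrix_mul_block f a e he hmem hsurj (parabolic_mem'.mp A.2) (parabolic_mem'.mp B.2)]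
    rfl


open scoped TensorProduct

/-- exterior tensor product of representations: the product group `∀ a, G a` acts on
`⨂[ℂ] a, V a` factorwise. -/
def piTensorRep {ι : Type*} [Fintype ι] {G : ι → Type*} [∀ a, Group (G a)]
    {V : ι → Type*} [∀ a, AddCommGroup (V a)] [∀ a, Module ℂ (V a)]
    (π : ∀ a, Representation ℂ (G a) (V a)) :
    Representation ℂ (∀ a, G a) (⨂[ℂ] a, V a) :=
  PiTensorProduct.mapMonoidHom.comp
    { toFun := fun g => fun a => π a (g a)
      map_one' := by funext a; simp
      map_mul' := fun g h => by funext a; simp }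

variable {G : Type*} [Group G] {W : Type*} [AddCommGroup W] [Module ℂ W]

/-- the space of the induced representation (function model): functions `φ : G → W`
with `φ (p * g) = x p (φ g)`. -/
def IndCarrier (P : Subgroup G) (x : Representation ℂ P W) : Submodule ℂ (G → W) where
  carrier := {φ | ∀ (p : P) (g : G), φ (↑p * g) = x p (φ g)}
  add_mem' := by
    intro φ ψ hφ hψ p g
    simp only [Pi.add_apply, hφ p g, hψ p g, map_add]
  zero_mem' := by
    intro p g
    simp
  smul_mem' := by
    intro c φ hφ p g
    simp only [Pi.smul_apply, hφ p g, _root_.map_smul]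

/-- the induced representation `Ind_P^G x` in the function model, `(g • φ) y = φ (y * g)`. -/
def IndRep (P : Subgroup G) (x : Representation ℂ P W) :
    Representation ℂ G (IndCarrier P x) where
  toFun g :=
    { toFun := fun φ => ⟨fun y => (φ : G → W) (y * g), by
        intro p y
        show (φ : G → W) (↑p * y * g) = _
        rw [mul_assoc]
        exact φ.2 p (y * g)⟩
      map_add' := fun φ ψ => by ext y; rfl
      map_smul' := fun c φ => by ext y; rfl }
  map_one' := by
    apply LinearMap.ext
    intro φ
    apply Subtype.ext
    funext y
    show (φ : G → W) (y * 1) = (φ : G → W) y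
    rw [mul_one]
  map_mul' g h := by
    apply LinearMap.ext
    intro φ
    apply Subtype.ext
    funext y
    show (φ : G → W) (y * (g * h)) = (φ : G → W) (y * g * h)
    rw [mul_assoc]


theorem unip_conj {f : Fin n → Fin m} {l A : GL (Fin n) F}
    (hl : l ∈ levi f) (hA : unipMem f (A : Matrix (Fin n) (Fin n) F)) :
    unipMem f ((l⁻¹ * A * l : GL (Fin n) F) : Matrix (Fin n) (Fin n) F) := by
  have hli : leviMem f ((l⁻¹ : GL (Fin n) F) : Matrix (Fin n) (Fin n) F) :=
    levi_mem'.mp ((levi f).inv_mem hl)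
  have hlm : leviMem f ((l : GL (Fin n) F) : Matrix (Fin n) (Fin n) F) := levi_mem'.mp hl
  set li := ((l⁻¹ : GL (Fin n) F) : Matrix (Fin n) (Fin n) F) with hli_def
  set lm := ((l : GL (Fin n) F) : Matrix (Fin n) (Fin n) F) with hlm_def
  set Am := ((A : GL (Fin n) F) : Matrix (Fin n) (Fin n) F) with hAm_def
  have hval : ((l⁻¹ * A * l : GL (Fin n) F) : Matrix (Fin n) (Fin n) F) = li * Am * lm := by
    rw [Units.val_mul, Units.val_mul]
  have hN : li * Am * lm = 1 + li * (Am - 1) * lm := by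
    have h1 : li * lm = 1 := by
      rw [hli_def, hlm_def, ← Units.val_mul, inv_mul_cancel, Units.val_one]
    rw [Matrix.mul_sub, Matrix.mul_one, Matrix.sub_mul, h1]
    abel
  intro i j hij
  rw [hval, hN, Matrix.add_apply]
  have hzero : (li * (Am - 1) * lm) i j = 0 := by
    rw [Matrix.mul_apply]
    apply Finset.sum_eq_zero
    intro t _
    by_cases ht : f t = f j
    · rw [Matrix.mul_apply]
      have : ∀ s ∈ Finset.univ, li i s * (Am - 1) s t = 0 := by
        intro s _
        by_cases hs : f i = f s
        · have hN0 : (Am - 1) s t = 0 := by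
            have : ¬ f s < f t := by rw [← hs, ht]; exact hij
            rw [Matrix.sub_apply, hA s t this, sub_self]
          rw [hN0, mul_zero]
        · rw [hli i s (fun h => hs h), zero_mul]
      rw [Finset.sum_eq_zero this, zero_mul]
    · rw [hlm t j ht, mul_zero]
  rw [hzero, add_zero]

variable {V : Type*} [AddCommGroup V] [Module ℂ V]

/-- the Jacquet restriction: the space of vectors invariant under the unipotent radical. -/
def jacquetModule (π : Representation ℂ (GL (Fin n) F) V) (f : Fin n → Fin m) :
    Submodule ℂ V where
  carrier := {v | ∀ A : GL (Fin n) F, unipMem f (A : Matrix (Fin n) (Fin n) F) → π A v = v}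
  add_mem' := fun hv hw A hA => by rw [map_add, hv A hA, hw A hA]
  zero_mem' := fun A hA => by simp
  smul_mem' := fun c v hv A hA => by rw [_root_.map_smul, hv A hA]

theorem jacquet_stable (π : Representation ℂ (GL (Fin n) F) V) (f : Fin n → Fin m)
    {l : GL (Fin n) F} (hl : l ∈ levi f) {v : V} (hv : v ∈ jacquetModule π f) :
    π l v ∈ jacquetModule π f := by
  intro A hA
  have key : A * l = l * (l⁻¹ * A * l) := by group
  have : π A (π l v) = π (A * l) v := by rw [_root_.map_mul]; rfl
  rw [this, key, _root_.map_mul]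
  have : π (l⁻¹ * A * l) v = v := hv _ (unip_conj hl hA)
  show π l (π (l⁻¹ * A * l) v) = π l v
  rw [this]

/-- the Jacquet restriction of `π` as a representation of the Levi subgroup. -/
def jacquetRep (π : Representation ℂ (GL (Fin n) F) V) (f : Fin n → Fin m) :
    Representation ℂ (levi (F := F) f) (jacquetModule π f) where
  toFun l := (π (l : GL (Fin n) F)).restrict (fun v hv => jacquet_stable π f l.2 hv)
  map_one' := by
    apply LinearMap.ext
    intro v
    apply Subtype.ext
    show π ((1 : levi (F := F) f) : GL (Fin n) F) (v : V) = (v : V)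
    rw [Subgroup.coe_one, _root_.map_one]
    rfl
  map_mul' l l' := by
    apply LinearMap.ext
    intro v
    apply Subtype.ext
    show π (((l * l' : levi (F := F) f)) : GL (Fin n) F) (v : V) = _
    rw [Subgroup.coe_mul, _root_.map_mul]
    rfl



section ParabolicInduction

variable {F : Type*} [Field F]

/-- the group homomorphism from a parabolic subgroup onto the product of the general linear
groups of its diagonal blocks. -/
def leviProjPi {N m : ℕ} (f : Fin N → Fin m) {k : Fin m → ℕ} (e : ∀ a, Fin (k a) → Fin N)
    (he : ∀ a, Function.Injective (e a)) (hmem : ∀ a i, f (e a i) = a)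
    (hsurj : ∀ a j, f j = a → ∃ i, e a i = j) :
    (parabolic (F := F) f) →* (∀ a, GL (Fin (k a)) F) :=
  Pi.monoidHom (fun a => leviProj f a (e a) (he a) (hmem a) (hsurj a))

/-- parabolic induction: the representation of `GL_N(F)` induced from the inflation to the
parabolic subgroup attached to `f` of the exterior tensor product of the `π a`. -/
def parabolicInd {N m : ℕ} (f : Fin N → Fin m) {k : Fin m → ℕ} (e : ∀ a, Fin (k a) → Fin N)
    (he : ∀ a, Function.Injective (e a)) (hmem : ∀ a i, f (e a i) = a)
    (hsurj : ∀ a j, f j = a → ∃ i, e a i = j)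
    {V : Fin m → Type*} [∀ a, AddCommGroup (V a)] [∀ a, Module ℂ (V a)]
    (π : ∀ a, Representation ℂ (GL (Fin (k a)) F) (V a)) :
    Representation ℂ (GL (Fin N) F)
      (IndCarrier (parabolic f) ((piTensorRep π).comp (leviProjPi f e he hmem hsurj))) :=
  IndRep (parabolic f) ((piTensorRep π).comp (leviProjPi f e he hmem hsurj))

end ParabolicInduction

/-- `A` is a monomial matrix (normalizes the diagonal torus) with underlying
permutation `σ`. -/
def IsMonomialWith {F : Type*} [Field F] {n : ℕ} (A : GL (Fin n) F)
    (σ : Equiv.Perm (Fin n)) : Prop :=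
  ∀ i j, i ≠ σ j → (A : Matrix (Fin n) (Fin n) F) i j = 0

/-- the space of equivariant linear maps between two representations. -/
def equivariantMaps {G V W : Type*} [Group G] [AddCommGroup V] [Module ℂ V]
    [AddCommGroup W] [Module ℂ W]
    (π : Representation ℂ G V) (π' : Representation ℂ G W) : Submodule ℂ (V →ₗ[ℂ] W) where
  carrier := {T | ∀ (g : G) (v : V), T (π g v) = π' g (T v)}
  add_mem' := by
    intro T S hT hS g v
    simp [hT g v, hS g v]
  zero_mem' := by intro g v; simp
  smul_mem' := by
    intro c T hT g v
    simp [hT g v]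

/-- a representation is self-dual -/
def SelfDual {G V : Type*} [Group G] [AddCommGroup V] [Module ℂ V]
    (π : Representation ℂ G V) : Prop :=
  RepIso π π.dual

/-- A finite-dimensional irreducible representation with a matrix coefficient that is
nonzero at `1` and invariant under `g ↦ g⁻¹` is self-dual. -/
theorem repIso_dual_of_symmetric_coefficient {G V : Type*} [Group G] [AddCommGroup V] [Module ℂ V]
    [FiniteDimensional ℂ V] (π : Representation ℂ G V) (hirr : IsIrred π) (v : V)
    (ℓ : Module.Dual ℂ V) (hv : ℓ v ≠ 0) (hsymm : ∀ g, ℓ (π g⁻¹ v) = ℓ (π g v)) :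
    RepIso π π.dual := by
  let L : V →ₗ[ℂ] (G → ℂ) := LinearMap.pi fun g => ℓ ∘ₗ π g
  let D : Module.Dual ℂ V →ₗ[ℂ] (G → ℂ) :=
    LinearMap.pi fun g => Module.Dual.eval ℂ V (π g⁻¹ v)
  have hL : ∀ x g, L x g = ℓ (π g x) := fun _ _ => rfl
  have hD : ∀ μ g, D μ g = μ (π g⁻¹ v) := fun _ _ => rfl
  have hDdual : ∀ g μ y, D (π.dual g μ) y = D μ (y * g) := by
    intro g μ y
    rw [hD, hD, _root_.mul_inv_rev, map_mul]
    rfl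
  have hLmul : ∀ g x y, L (π g x) y = L x (y * g) := by
    intro g x y
    rw [hL, hL, map_mul]
    rfl
  have hv0 : v ≠ 0 := by
    rintro rfl
    exact hv (map_zero ℓ)
  have hDinj : Function.Injective D := by
    rw [← LinearMap.ker_eq_bot, LinearMap.ker_eq_bot']
    intro μ hμ
    have hμ' : ∀ g, μ (π g v) = 0 := by
      intro g
      have := congrFun hμ g⁻¹
      rwa [hD, inv_inv] at this
    rcases hirr.2 (⨅ g, LinearMap.ker (μ ∘ₗ π g)) (by
      intro g w hw
      rw [Submodule.mem_iInf] at hw ⊢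
      intro y
      have := hw (y * g)
      rw [LinearMap.mem_ker, LinearMap.comp_apply] at this ⊢
      rwa [map_mul] at this) with h | h
    · exfalso
      apply hv0
      rw [← Submodule.mem_bot ℂ, ← h, Submodule.mem_iInf]
      exact hμ'
    · ext x
      have hx : x ∈ ⨅ g, LinearMap.ker (μ ∘ₗ π g) := h ▸ Submodule.mem_top
      rw [Submodule.mem_iInf] at hx
      simpa using hx 1
  have hLinj : Function.Injective L := by
    rw [← LinearMap.ker_eq_bot]
    rcases hirr.2 (LinearMap.ker L) (by
      intro g w hw
      rw [LinearMap.mem_ker] at hw ⊢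
      funext y
      rw [hLmul, hw]
      rfl) with h | h
    · exact h
    · exfalso
      have hmem : v ∈ LinearMap.ker L := h ▸ Submodule.mem_top
      have := congrFun (LinearMap.mem_ker.mp hmem) 1
      rw [hL, map_one] at this
      exact hv this
  have hrange : ∀ x, L x ∈ LinearMap.range D := by
    rcases hirr.2 ((LinearMap.range D).comap L) (by
      rintro g w ⟨μ, hμ⟩
      refine ⟨π.dual g μ, ?_⟩
      funext y
      rw [hDdual, hLmul, hμ]) with h | h
    · exfalso
      apply hv0
      rw [← Submodule.mem_bot ℂ, ← h]
      refine ⟨ℓ, ?_⟩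
      funext g
      exact hsymm g
    · intro x
      have : x ∈ (LinearMap.range D).comap L := h ▸ Submodule.mem_top
      exact this
  let E : V →ₗ[ℂ] Module.Dual ℂ V :=
    (LinearEquiv.ofInjective D hDinj).symm.toLinearMap ∘ₗ L.codRestrict _ hrange
  have hE : ∀ x, D (E x) = L x := fun x =>
    congrArg Subtype.val ((LinearEquiv.ofInjective D hDinj).apply_symm_apply
      (L.codRestrict _ hrange x))
  have hEinj : Function.Injective E := fun x y hxy => hLinj (by rw [← hE, ← hE, hxy])
  refine ⟨E.linearEquivOfInjective hEinj Subspace.dual_finrank_eq.symm, fun g x => ?_⟩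
  apply hDinj
  simp only [LinearMap.linearEquivOfInjective_apply]
  funext y
  rw [hE, hLmul, hDdual, hE]

/-- A common eigenvector of a subgroup of a finite group is detected by an eigenfunctional with
the same eigenvalues. -/
theorem exists_eigenfunctional {G V : Type*} [Group G] [Finite G] [AddCommGroup V] [Module ℂ V]
    (π : Representation ℂ G V) (K : Subgroup G) (v : V) (hv : v ≠ 0)
    (hK : ∀ g ∈ K, ∃ c : ℂ, π g v = c • v) :
    ∃ ℓ : Module.Dual ℂ V, ℓ v ≠ 0 ∧
      ∀ g ∈ K, ∀ c : ℂ, π g v = c • v → ∀ x, ℓ (π g x) = c * ℓ x := by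
  have := Fintype.ofFinite K
  obtain ⟨ℓ₀, hℓ₀⟩ := Module.Projective.exists_dual_ne_zero ℂ hv
  refine ⟨∑ g : K, ℓ₀ (π (g : G)⁻¹ v) • (ℓ₀ ∘ₗ π (g : G)), ?_, ?_⟩
  · have hterm : ∀ g : K, (ℓ₀ (π (g : G)⁻¹ v) • (ℓ₀ ∘ₗ π (g : G))) v = ℓ₀ v * ℓ₀ v := by
      intro g
      obtain ⟨c, hc⟩ := hK g g.2
      obtain ⟨d, hd⟩ := hK (g : G)⁻¹ (K.inv_mem g.2)
      have hdc : (d * c) • v = v := by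
        have h : π (g : G)⁻¹ (π (g : G) v) = v := by simp
        rw [hc, map_smul, hd, smul_smul] at h
        rwa [mul_comm]
      have h1 : d * c * ℓ₀ v = ℓ₀ v := by
        have := congrArg ℓ₀ hdc
        rwa [map_smul, smul_eq_mul] at this
      rw [LinearMap.smul_apply, LinearMap.comp_apply, hc, hd, map_smul, map_smul, smul_eq_mul,
        smul_eq_mul, smul_eq_mul]
      linear_combination ℓ₀ v * h1
    rw [LinearMap.sum_apply, Finset.sum_congr rfl fun g _ => hterm g, Finset.sum_const,
      nsmul_eq_mul]
    refine mul_ne_zero ?_ (mul_ne_zero hℓ₀ hℓ₀)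
    exact_mod_cast (Finset.card_pos.mpr ⟨1, Finset.mem_univ _⟩).ne'
  · intro g hg c hc x
    rw [LinearMap.sum_apply, LinearMap.sum_apply, Finset.mul_sum]
    refine Fintype.sum_equiv (Equiv.mulRight ⟨g, hg⟩) _ _ fun k => ?_
    obtain ⟨d, hd⟩ := hK (k : G)⁻¹ (K.inv_mem k.2)
    have hgv : c • π g⁻¹ v = v := by
      rw [← map_smul, ← hc]
      simp
    have hkg : π (k : G)⁻¹ v = c • π ((k : G) * g)⁻¹ v := by
      rw [_root_.mul_inv_rev, map_mul, Module.End.mul_apply, hd, map_smul, smul_comm, hgv]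
    simp only [LinearMap.smul_apply, LinearMap.comp_apply, Equiv.coe_mulRight, Subgroup.coe_mul,
      smul_eq_mul]
    rw [hkg, map_smul, smul_eq_mul, map_mul π (k : G) g, Module.End.mul_apply, mul_assoc]

/-- If no nonzero vector is fixed by `U`, then a functional that is constant on the `U`-orbit of a
vector vanishes on that vector. -/
theorem eq_zero_of_constant_on_orbit {G V : Type*} [Group G] [Finite G] [AddCommGroup V]
    [Module ℂ V] (π : Representation ℂ G V) (U : Subgroup G)
    (hU : ∀ v, (∀ u ∈ U, π u v = v) → v = 0) (ℓ : Module.Dual ℂ V) (x : V)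
    (hx : ∀ u ∈ U, ℓ (π u x) = ℓ x) : ℓ x = 0 := by
  have := Fintype.ofFinite U
  have hsum : ∑ u : U, π (u : G) x = 0 := by
    refine hU _ fun a ha => ?_
    rw [map_sum]
    refine Fintype.sum_equiv (Equiv.mulLeft ⟨a, ha⟩) _ _ fun u => ?_
    simp
  have h := congrArg ℓ hsum
  rw [map_sum, map_zero, Finset.sum_congr rfl fun (u : U) _ => hx u u.2, Finset.sum_const,
    nsmul_eq_mul, mul_eq_zero] at h
  refine h.resolve_left ?_
  exact_mod_cast (Finset.card_pos.mpr ⟨1, Finset.mem_univ _⟩).ne'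

/-- Some positive power of an element of a finite monoid is idempotent. -/
theorem exists_pow_idempotent {M : Type*} [Monoid M] [Finite M] (x : M) :
    ∃ k, 0 < k ∧ x ^ k * x ^ k = x ^ k := by
  obtain ⟨a, b, hne, hab⟩ := Finite.exists_ne_map_eq_of_infinite fun i : ℕ => x ^ (i + 1)
  wlog hlt : a < b generalizing a b
  · exact this b a hne.symm hab.symm (by omega)
  obtain ⟨p, hp, rfl⟩ : ∃ p, 0 < p ∧ b = a + p := ⟨b - a, by omega, by omega⟩
  have hab' : x ^ (a + 1) * x ^ p = x ^ (a + 1) := by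
    rw [← pow_add, hab]
    congr 1
    omega
  have hmul : ∀ j, x ^ (a + 1) * x ^ (p * j) = x ^ (a + 1) := by
    intro j
    induction j with
    | zero => simp
    | succ j ih => rw [Nat.mul_succ, pow_add x (p * j), ← mul_assoc, ih, hab']
  refine ⟨(a + 1) * p, by positivity, ?_⟩
  obtain ⟨r, hr⟩ : ∃ r, (a + 1) * p = r + (a + 1) :=
    ⟨(a + 1) * p - (a + 1), by have := Nat.le_mul_of_pos_right (a + 1) hp; omega⟩
  calc x ^ ((a + 1) * p) * x ^ ((a + 1) * p)
      = x ^ (r + (a + 1)) * x ^ (p * (a + 1)) := by rw [← hr, mul_comm p]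
    _ = x ^ ((a + 1) * p) := by rw [pow_add, mul_assoc, hmul, ← pow_add, ← hr]

/-- The unit `1 + y` attached to an element `y` of square zero. -/
def oneAddUnit {R : Type*} [Ring R] (y : R) (hy : y * y = 0) : Rˣ where
  val := 1 + y
  inv := 1 - y
  val_inv := by
    have h : (1 + y) * (1 - y) = 1 - y * y := by noncomm_ring
    rw [h, hy, sub_zero]
  inv_val := by
    have h : (1 - y) * (1 + y) = 1 - y * y := by noncomm_ring
    rw [h, hy, sub_zero]

/-- The unipotent group of units `1 + x` with `x = e x (1 - e)`, for an idempotent `e`. -/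
def idemUnipotent {R : Type*} [Ring R] (e : R) (he : e * e = e) : Subgroup Rˣ where
  carrier := {u | e * (u - 1) * (1 - e) = u - 1}
  one_mem' := by simp
  mul_mem' := by
    intro u w hu hw
    have h0 : ((u : R) - 1) * (w - 1) = 0 := by
      have h1 : (1 - e) * e = 0 := by rw [sub_mul, one_mul, he, sub_self]
      rw [← hu, ← hw]
      simp only [mul_assoc]
      rw [← mul_assoc (1 - e) e, h1]
      simp
    have h : ((u * w : Rˣ) : R) - 1 = (u - 1) + (w - 1) := by
      have h2 : (u : R) * w - 1 = (u - 1) + (w - 1) + (u - 1) * (w - 1) := by noncomm_ring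
      rw [Units.val_mul, h2, h0, add_zero]
    change e * (((u * w : Rˣ) : R) - 1) * (1 - e) = ((u * w : Rˣ) : R) - 1
    rw [h, mul_add, add_mul, hu, hw]
  inv_mem' := by
    intro u hu
    have h0 : ((u : R) - 1) * (u - 1) = 0 := by
      have h1 : (1 - e) * e = 0 := by rw [sub_mul, one_mul, he, sub_self]
      nth_rw 1 [← hu]
      rw [← hu]
      simp only [mul_assoc]
      rw [← mul_assoc (1 - e) e, h1]
      simp
    have h : ((u⁻¹ : Rˣ) : R) = 2 - u := by
      apply Units.inv_eq_of_mul_eq_one_right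
      have h2 : (u : R) * (2 - u) = 1 - (u - 1) * (u - 1) := by noncomm_ring
      rw [h2, h0, sub_zero]
    have h2 : ((u⁻¹ : Rˣ) : R) - 1 = -((u : R) - 1) := by
      rw [h, neg_sub, ← one_add_one_eq_two]
      abel
    change e * (((u⁻¹ : Rˣ) : R) - 1) * (1 - e) = ((u⁻¹ : Rˣ) : R) - 1
    rw [h2, mul_neg, neg_mul, hu]

theorem mem_idemUnipotent {R : Type*} [Ring R] {e : R} {he : e * e = e} {u : Rˣ} :
    u ∈ idemUnipotent e he ↔ e * (u - 1) * (1 - e) = (u : R) - 1 := Iff.rfl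

/-- Let `a`, `b` be units of a finite ring with `a ^ 2 = b ^ 2` central, and `e` an idempotent
commuting with both such that `1 - e` is a power of `(a + b) ^ 2`. Then every element of
`e R (1 - e)` is the sum of one commuting with `a` and one commuting with `b`. -/
theorem exists_add_commute {R : Type*} [Ring R] [Finite R] (a b : Rˣ) (e : R) (he : e * e = e)
    (hab : a * a = b * b) (hcen : ∀ x : R, a * a * x = x * (a * a))
    (hea : Commute e a) (heb : Commute e b) (k : ℕ)
    (hk : (((a : R) + b) ^ 2) ^ k = 1 - e) (x : R) (hx : e * x * (1 - e) = x) :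
    ∃ y z : R, e * y * (1 - e) = y ∧ e * z * (1 - e) = z ∧ x = y + z ∧
      Commute (a : R) y ∧ Commute (b : R) z := by
  have hab' : (a : R) * a = b * b := by exact_mod_cast congrArg Units.val hab
  have hcenb : ∀ x : R, b * b * x = x * (b * b) := by
    rw [← hab']
    exact hcen
  have hconj : ∀ u : Rˣ, Commute e (u : R) → ∀ q : R, e * q * (1 - e) = q →
      e * (u * q * (u⁻¹ : Rˣ)) * (1 - e) = u * q * (u⁻¹ : Rˣ) := by
    intro u hu q hq
    have hu' : Commute (1 - e) ((u⁻¹ : Rˣ) : R) :=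
      (Commute.one_left _).sub_left hu.units_inv_right
    calc e * (u * q * (u⁻¹ : Rˣ)) * (1 - e) = (e * u) * q * ((u⁻¹ : Rˣ) * (1 - e)) := by
          simp only [mul_assoc]
      _ = u * (e * q * (1 - e)) * (u⁻¹ : Rˣ) := by
          rw [hu.eq, ← hu'.eq]
          simp only [mul_assoc]
      _ = u * q * (u⁻¹ : Rˣ) := by rw [hq]
  let S : AddSubgroup R :=
    { carrier := {q | e * q * (1 - e) = q}
      zero_mem' := by simp
      add_mem' := by
        intro p q hp hq
        change e * (p + q) * (1 - e) = p + q
        rw [mul_add, add_mul, hp, hq]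
      neg_mem' := by
        intro p hp
        change e * -p * (1 - e) = -p
        rw [mul_neg, neg_mul, hp] }
  let δ : S →+ S :=
    { toFun := fun q => ⟨a * q * (a⁻¹ : Rˣ), hconj a hea q q.2⟩ -
        ⟨b * q * (b⁻¹ : Rˣ), hconj b heb q q.2⟩
      map_zero' := by simp
      map_add' := by
        intro p q
        apply Subtype.ext
        simp only [AddSubgroup.coe_add, AddSubgroup.coe_sub]
        noncomm_ring }
  have hδ : ∀ q : S, ((δ q : S) : R) = a * q * (a⁻¹ : Rˣ) - b * q * (b⁻¹ : Rˣ) := fun _ => rfl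
  have hinj : Function.Injective δ := by
    rw [injective_iff_map_eq_zero]
    rintro ⟨q, hq⟩ hq0
    have hq' : e * q * (1 - e) = q := hq
    obtain ⟨p, hp⟩ : ∃ p : R, p = a * q * (a⁻¹ : Rˣ) := ⟨_, rfl⟩
    have hpb : p = b * q * (b⁻¹ : Rˣ) := by
      have := congrArg Subtype.val hq0
      rw [hδ] at this
      rw [hp]
      exact sub_eq_zero.mp this
    have h1 : p * a = a * q := by rw [hp, Units.inv_mul_cancel_right]
    have h2 : p * b = b * q := by rw [hpb, Units.inv_mul_cancel_right]
    have h3 : a * p = q * a := by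
      rw [← Units.mul_left_inj a, mul_assoc, h1, ← mul_assoc, hcen, mul_assoc]
    have h4 : b * p = q * b := by
      rw [← Units.mul_left_inj b, mul_assoc, h2, ← mul_assoc, hcenb, mul_assoc]
    have h5 : SemiconjBy q (((a : R) + b) ^ 2) (((a : R) + b) ^ 2) := by
      change q * ((a : R) + b) ^ 2 = ((a : R) + b) ^ 2 * q
      rw [pow_two, ← mul_assoc, mul_add q, ← h3, ← h4, ← add_mul, mul_assoc, mul_add p, h1, h2,
        ← add_mul, ← mul_assoc]
    have h6 : q * (1 - e) = (1 - e) * q := hk ▸ (h5.pow_right k).eq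
    apply Subtype.ext
    change q = 0
    rw [← hq', mul_assoc, h6, ← mul_assoc, mul_sub, mul_one, he, sub_self, zero_mul]
  obtain ⟨⟨q, hq⟩, hqx⟩ := Finite.surjective_of_injective hinj ⟨x, hx⟩
  have hqx' : a * q * (a⁻¹ : Rˣ) - b * q * (b⁻¹ : Rˣ) = x := congrArg Subtype.val hqx
  refine ⟨q + a * q * (a⁻¹ : Rˣ), -(q + b * q * (b⁻¹ : Rˣ)),
    S.add_mem hq (hconj a hea q hq), S.neg_mem (S.add_mem hq (hconj b heb q hq)), ?_, ?_, ?_⟩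
  · rw [← hqx']
    abel
  · change a * (q + a * q * (a⁻¹ : Rˣ)) = (q + a * q * (a⁻¹ : Rˣ)) * a
    rw [mul_add, add_mul, Units.inv_mul_cancel_right, ← mul_assoc, ← mul_assoc, hcen, ← mul_assoc,
      Units.mul_inv_cancel_right, add_comm]
  · apply Commute.neg_right
    change b * (q + b * q * (b⁻¹ : Rˣ)) = (q + b * q * (b⁻¹ : Rˣ)) * b
    rw [mul_add, add_mul, Units.inv_mul_cancel_right, ← mul_assoc, ← mul_assoc, hcenb, ← mul_assoc,
      Units.mul_inv_cancel_right, add_comm]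

/-- An idempotent matrix is conjugate to a standard diagonal idempotent. -/
theorem exists_conj_standard_idempotent {F : Type*} [Field F] {n : ℕ}
    (e : Matrix (Fin n) (Fin n) F) (he : e * e = e) (h0 : e ≠ 0) (h1 : e ≠ 1) :
    ∃ (k : ℕ) (p : GL (Fin n) F), 0 < k ∧ k < n ∧
      e * (p : Matrix (Fin n) (Fin n) F) =
        (p : Matrix (Fin n) (Fin n) F) * Matrix.diagonal fun i : Fin n => if (i : ℕ) < k then 1 else 0 := by
  have hidem : IsIdempotentElem (Matrix.toLin' e) := by
    rw [IsIdempotentElem, Module.End.mul_eq_comp, ← Matrix.toLin'_mul, he]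
  have hcompl := LinearMap.IsIdempotentElem.isCompl hidem
  set U := LinearMap.range (Matrix.toLin' e) with hU
  set W := LinearMap.ker (Matrix.toLin' e) with hW
  have hrank : Module.finrank F U + Module.finrank F W = n := by
    rw [Submodule.finrank_add_eq_of_isCompl hcompl, Module.finrank_fin_fun]
  let b₀ := ((Module.finBasis F U).prod (Module.finBasis F W)).map
    (U.prodEquivOfIsCompl W hcompl)
  let b := b₀.reindex (finSumFinEquiv.trans (finCongr hrank))
  have hb : ∀ i, e *ᵥ b i = (if (i : ℕ) < Module.finrank F U then (1 : F) else 0) • b i := by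
    intro i
    obtain ⟨j, rfl⟩ := (finSumFinEquiv.trans (finCongr hrank)).surjective i
    have hbj : b ((finSumFinEquiv.trans (finCongr hrank)) j) = b₀ j := by simp [b]
    rw [hbj]
    rcases j with j | j
    · have hmem : b₀ (Sum.inl j) ∈ U := by simp [b₀]
      obtain ⟨y, hy⟩ := hmem
      rw [← hy, Matrix.toLin'_apply, Matrix.mulVec_mulVec, he]
      simp
    · have hmem : b₀ (Sum.inr j) ∈ W := by simp [b₀]
      have hzero : e *ᵥ b₀ (Sum.inr j) = 0 := LinearMap.mem_ker.mp hmem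
      rw [hzero]
      simp
  let p : GL (Fin n) F :=
    { val := (Pi.basisFun F (Fin n)).toMatrix b
      inv := b.toMatrix (Pi.basisFun F (Fin n))
      val_inv := Module.Basis.toMatrix_mul_toMatrix_flip _ _
      inv_val := Module.Basis.toMatrix_mul_toMatrix_flip _ _ }
  have hp : ∀ i j, (p : Matrix (Fin n) (Fin n) F) i j = b j i := fun _ _ => rfl
  refine ⟨Module.finrank F U, p, ?_, ?_, ?_⟩
  · rw [Module.finrank_pos_iff_exists_ne_zero]
    by_contra! h
    apply h0
    apply Matrix.toLin'.injective
    rw [map_zero, ← LinearMap.range_eq_bot, ← hU, eq_bot_iff]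
    intro x hx
    simpa using congrArg Subtype.val (h ⟨x, hx⟩)
  · have hpos : 0 < Module.finrank F W := by
      rw [Module.finrank_pos_iff_exists_ne_zero]
      by_contra! h
      apply h1
      have hinj : Function.Injective (Matrix.toLin' e) := by
        rw [← LinearMap.ker_eq_bot, ← hW, eq_bot_iff]
        intro x hx
        simpa using congrArg Subtype.val (h ⟨x, hx⟩)
      apply Matrix.toLin'.injective
      refine LinearMap.ext fun x => hinj ?_
      rw [Matrix.toLin'_one, LinearMap.id_apply, Matrix.toLin'_apply, Matrix.toLin'_apply,
        Matrix.mulVec_mulVec, he]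
    omega
  · ext i j
    rw [Matrix.mul_diagonal, hp]
    have := congrFun (hb j) i
    rw [Pi.smul_apply, smul_eq_mul, mul_comm] at this
    exact this

theorem IsCuspidal.eq_zero_of_forall_idemUnipotent {F : Type*} [Field F] {n : ℕ} {V : Type*}
    [AddCommGroup V] [Module ℂ V] {π : Representation ℂ (GL (Fin n) F) V} (hπ : IsCuspidal π)
    (e : Matrix (Fin n) (Fin n) F) (he : e * e = e) (h0 : e ≠ 0) (h1 : e ≠ 1) (v : V)
    (hv : ∀ u ∈ idemUnipotent e he, π u v = v) : v = 0 := by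
  obtain ⟨k, p, hk0, hkn, hp⟩ := exists_conj_standard_idempotent e he h0 h1
  set d : Matrix (Fin n) (Fin n) F :=
    Matrix.diagonal fun i : Fin n => if (i : ℕ) < k then 1 else 0 with hd
  let f : Fin n → Fin 2 := fun i => if (i : ℕ) < k then 0 else 1
  have hzero : π p⁻¹ v = 0 := by
    refine hπ 2 f le_rfl ?_ ?_ _ ?_
    · intro i j hij
      have hij' : (i : ℕ) ≤ j := hij
      simp only [f]
      split_ifs with h2 h3
      · exact le_rfl
      · exact Fin.zero_le _
      · omega
      · exact le_rfl
    · intro a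
      fin_cases a
      · exact ⟨⟨0, by omega⟩, by simp [f, hk0]⟩
      · exact ⟨⟨k, hkn⟩, by simp [f]⟩
    · intro a ha
      have hda : d * ((a : Matrix (Fin n) (Fin n) F) - 1) * (1 - d) = a - 1 := by
        have h1d : (1 : Matrix (Fin n) (Fin n) F) - d =
            Matrix.diagonal fun i : Fin n => if (i : ℕ) < k then (0 : F) else 1 := by
          rw [hd, ← Matrix.diagonal_one, Matrix.diagonal_sub]
          congr 1
          funext i
          split_ifs <;> simp
        ext i j
        rw [h1d, hd, Matrix.mul_diagonal, Matrix.diagonal_mul]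
        by_cases hi : (i : ℕ) < k <;> by_cases hj : (j : ℕ) < k
        · have := ha i j (by simp [f, hi, hj])
          simp [hj, this]
        · simp [hi, hj]
        · have := ha i j (by simp [f, hi, hj])
          simp [hj, this]
        · have := ha i j (by simp [f, hi, hj])
          simp [hi, this]
      have hdp : d * ((p⁻¹ : GL (Fin n) F) : Matrix (Fin n) (Fin n) F) =
          ((p⁻¹ : GL (Fin n) F) : Matrix (Fin n) (Fin n) F) * e := by
        rw [← Units.mul_right_inj p, ← mul_assoc, ← hp, Units.mul_inv_cancel_right,
          Units.mul_inv_cancel_left]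
      have hmem : p * a * p⁻¹ ∈ idemUnipotent e he := by
        rw [mem_idemUnipotent]
        have hval : ((p * a * p⁻¹ : GL (Fin n) F) : Matrix (Fin n) (Fin n) F) - 1 =
            p * ((a : Matrix (Fin n) (Fin n) F) - 1) *
              ((p⁻¹ : GL (Fin n) F) : Matrix (Fin n) (Fin n) F) := by
          rw [mul_sub, sub_mul, mul_one, Units.mul_inv, Units.val_mul, Units.val_mul]
        have hpe : ((p⁻¹ : GL (Fin n) F) : Matrix (Fin n) (Fin n) F) * (1 - e) =
            (1 - d) * ((p⁻¹ : GL (Fin n) F) : Matrix (Fin n) (Fin n) F) := by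
          rw [mul_sub, sub_mul, hdp, mul_one, one_mul]
        rw [hval]
        calc e * (p * ((a : Matrix (Fin n) (Fin n) F) - 1) *
              ((p⁻¹ : GL (Fin n) F) : Matrix (Fin n) (Fin n) F)) * (1 - e)
            = e * p * ((a : Matrix (Fin n) (Fin n) F) - 1) *
              (((p⁻¹ : GL (Fin n) F) : Matrix (Fin n) (Fin n) F) * (1 - e)) := by
              simp only [mul_assoc]
          _ = p * (d * ((a : Matrix (Fin n) (Fin n) F) - 1) * (1 - d)) *
              ((p⁻¹ : GL (Fin n) F) : Matrix (Fin n) (Fin n) F) := by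
              rw [hpe, hp]
              noncomm_ring
          _ = _ := by rw [hda]
      have h := congrArg (π p⁻¹) (hv _ hmem)
      rw [← Module.End.mul_apply, ← map_mul] at h
      rw [← Module.End.mul_apply, ← map_mul]
      convert h using 3
      group
  have := congrArg (π p) hzero
  simpa using this

/-- The subgroup of elements conjugating `a` to `a` or `-a`. -/
def signCentralizer {R : Type*} [Ring R] (a : Rˣ) : Subgroup Rˣ where
  carrier := {g | g * a = a * g ∨ g * a = -a * g}
  one_mem' := by simp
  mul_mem' := by
    rintro g h (hg | hg) (hh | hh)
    · left; rw [mul_assoc, hh, ← mul_assoc, hg, mul_assoc]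
    · right
      rw [mul_assoc, hh, ← mul_assoc, mul_neg, hg]
      simp only [neg_mul, mul_assoc]
    · right; rw [mul_assoc, hh, ← mul_assoc, hg, mul_assoc]
    · left
      rw [mul_assoc, hh, ← mul_assoc, mul_neg, hg]
      simp only [neg_mul, neg_neg, mul_assoc]
  inv_mem' := by
    rintro g (hg | hg)
    · left
      rw [inv_mul_eq_iff_eq_mul, ← mul_assoc, hg, mul_inv_cancel_right]
    · right
      rw [inv_mul_eq_iff_eq_mul, neg_mul, mul_neg, ← mul_assoc, hg, neg_mul, neg_mul, neg_neg,
        mul_inv_cancel_right]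

/-- A vector fixed by the centralizer of `a` yields a nonzero common eigenvector of the sign
centralizer that is fixed by the centralizer. -/
theorem exists_sign_eigenvector {R V : Type*} [Ring R] [AddCommGroup V] [Module ℂ V]
    (π : Representation ℂ Rˣ V) (a : Rˣ)
    (hdist : HasInvVec π (Subgroup.centralizer {a} : Set Rˣ)) :
    ∃ v : V, v ≠ 0 ∧ (∀ g, g * a = a * g → π g v = v) ∧
      ∃ ε : ℂ, ∀ g, g * a = -a * g → π g v = ε • v := by
  obtain ⟨v₀, hv₀, hinv⟩ := hdist
  have hfix : ∀ g, g * a = a * g → π g v₀ = v₀ := fun g hg =>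
    hinv g (Subgroup.mem_centralizer_singleton_iff.mpr hg)
  by_cases hw : ∃ w, w * a = -a * w
  · obtain ⟨w, hw⟩ := hw
    have hfixw : ∀ g, g * a = a * g → π g (π w v₀) = π w v₀ := by
      intro g hg
      have h : w⁻¹ * g * w * a = a * (w⁻¹ * g * w) := by
        have hw' : a * w⁻¹ = -(w⁻¹ * a) := by
          rw [← mul_right_inj w, ← mul_assoc, hw, mul_neg, neg_mul, neg_mul,
            mul_inv_cancel_right, mul_inv_cancel_left]
        calc w⁻¹ * g * w * a = w⁻¹ * g * (w * a) := by group
          _ = -(w⁻¹ * (g * a) * w) := by rw [hw]; simp only [neg_mul, mul_neg, mul_assoc]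
          _ = -(w⁻¹ * a) * (g * w) := by rw [hg]; simp only [neg_mul, mul_assoc]
          _ = a * (w⁻¹ * g * w) := by rw [← hw']; group
      have h2 := congrArg (π w) (hfix _ h)
      rw [← Module.End.mul_apply, ← map_mul] at h2 ⊢
      rw [← h2]
      congr 2
      group
    have hsq : ∀ g, g * a = -a * g → π g (π w v₀) = v₀ := by
      intro g hg
      rw [← Module.End.mul_apply, ← map_mul]
      apply hfix
      rw [mul_assoc, hw, neg_mul, mul_neg, ← mul_assoc, hg, neg_mul, neg_mul, neg_neg, mul_assoc]
    have hone : ∀ g, g * a = -a * g → π g v₀ = π w v₀ := by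
      intro g hg
      have h : w⁻¹ * g * a = a * (w⁻¹ * g) := by
        have hw' : a * w⁻¹ = -(w⁻¹ * a) := by
          rw [← mul_right_inj w, ← mul_assoc, hw, mul_neg, neg_mul, neg_mul,
            mul_inv_cancel_right, mul_inv_cancel_left]
        rw [← mul_assoc, hw', mul_assoc, hg]
        simp only [neg_mul, mul_neg, mul_assoc]
      have h2 := congrArg (π w) (hfix _ h)
      rw [← Module.End.mul_apply, ← map_mul, mul_inv_cancel_left] at h2
      exact h2
    by_cases hsum : v₀ + π w v₀ = 0
    · refine ⟨v₀, hv₀, hfix, -1, fun g hg => ?_⟩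
      rw [hone g hg, neg_one_smul]
      exact eq_neg_of_add_eq_zero_right hsum
    · refine ⟨v₀ + π w v₀, hsum, fun g hg => ?_, 1, fun g hg => ?_⟩
      · rw [map_add, hfix g hg, hfixw g hg]
      · rw [map_add, hone g hg, hsq g hg, one_smul, add_comm]
  · exact ⟨v₀, hv₀, hfix, 1, fun g hg => absurd ⟨g, hg⟩ hw⟩

/-- For units `a`, `b = g a g⁻¹` of a finite ring with `2` invertible and `a ^ 2` central, either
`g⁻¹` is obtained from `g` by multiplying by elements of the sign centralizer of the same sign, or
some nontrivial idempotent commutes with `a` and `b` and has the form `1 - ((a + b) ^ 2) ^ k`. -/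
theorem inv_eq_or_exists_idempotent {R : Type*} [Ring R] [Finite R] (h2 : IsUnit (2 : R))
    (a g : Rˣ) (hcen : ∀ x : R, a * a * x = x * (a * a)) :
    (∃ s t : Rˣ, g⁻¹ = s * g * t⁻¹ ∧
      (s * a = a * s ∧ t * a = a * t ∨ s * a = -a * s ∧ t * a = -a * t)) ∨
    ∃ (e : R) (k : ℕ), e * e = e ∧ e ≠ 0 ∧ e ≠ 1 ∧ Commute e (a : R) ∧
      Commute e ((g * a * g⁻¹ : Rˣ) : R) ∧
      (((a : R) + (g * a * g⁻¹ : Rˣ)) ^ 2) ^ k = 1 - e := by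
  obtain ⟨b, hb⟩ : ∃ b, b = g * a * g⁻¹ := ⟨_, rfl⟩
  rw [← hb]
  have hbg : b * g = g * a := by rw [hb]; group
  have hcenu : ∀ x : Rˣ, a * a * x = x * (a * a) := fun x => Units.ext (hcen x)
  have hab : a * a = b * b := by
    have : b * b = g * (a * a) * g⁻¹ := by rw [hb]; group
    rw [this, ← hcenu, mul_inv_cancel_right]
  have hab' : (a : R) * a = b * b := by exact_mod_cast congrArg Units.val hab
  have hcenb : ∀ x : R, b * b * x = x * (b * b) := by
    rw [← hab']
    exact hcen
  set c : R := ((a : R) + b) ^ 2 with hc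
  have hac : Commute (a : R) c := by
    change (a : R) * c = c * a
    have h1 : (a : R) * c = a * a * a + a * a * b + a * b * a + a * (b * b) := by
      rw [hc]; noncomm_ring
    have h3 : c * a = a * a * a + b * (a * a) + a * b * a + (b * b) * a := by
      rw [hc]; noncomm_ring
    rw [h1, h3, hcen, hcenb a, hcen]
  have hbc : Commute (b : R) c := by
    change (b : R) * c = c * b
    have h1 : (b : R) * c = b * (a * a) + b * b * a + b * a * b + b * (b * b) := by
      rw [hc]; noncomm_ring
    have h3 : c * b = (a * a) * b + a * (b * b) + b * a * b + (b * b) * b := by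
      rw [hc]; noncomm_ring
    rw [h1, h3, hcen, hcenb a, hcenb b]
  obtain ⟨k, hk0, hk⟩ := exists_pow_idempotent c
  by_cases h1 : c ^ k = 1
  · left
    have hunit : IsUnit ((a : R) + b) := by
      have : IsUnit c := (isUnit_pow_iff hk0.ne').mp (h1 ▸ isUnit_one)
      rw [hc] at this
      exact (isUnit_pow_iff two_ne_zero).mp this
    obtain ⟨d, hd⟩ := hunit
    have hda : a * d = d * b := by
      ext1
      rw [Units.val_mul, Units.val_mul, hd, mul_add, add_mul, hab', add_comm]
    have hdb : b * d = d * a := by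
      ext1
      rw [Units.val_mul, Units.val_mul, hd, mul_add, add_mul, hab', add_comm]
    refine ⟨g⁻¹ * d, d * g, by group, Or.inl ⟨?_, ?_⟩⟩
    · rw [mul_assoc, ← hdb, hb]
      group
    · rw [mul_assoc, ← hbg, ← mul_assoc, ← hda, mul_assoc]
  by_cases h0 : c ^ k = 0
  · left
    have hunit : IsUnit ((a : R) - b) := by
      have hsq : ((a : R) - b) ^ 2 = 2 * 2 * (a * a) - c := by
        have : ((a : R) - b) ^ 2 = 2 * (a * a) + 2 * (b * b) - c := by
          rw [hc]; noncomm_ring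
        rw [this, ← hab']
        noncomm_ring
      have hu : IsUnit (2 * 2 * ((a : R) * a)) := (h2.mul h2).mul (a.isUnit.mul a.isUnit)
      have hcomm : Commute (2 * 2 * ((a : R) * a)) c :=
        (((Nat.cast_commute 2 c).mul_left (Nat.cast_commute 2 c))).mul_left (hac.mul_left hac)
      have hnil : IsNilpotent c := ⟨k, h0⟩
      rw [← isUnit_pow_iff two_ne_zero, hsq, sub_eq_add_neg]
      exact hnil.neg.isUnit_add_left_of_commute hu hcomm.symm.neg_left
    obtain ⟨d, hd⟩ := hunit
    have hda : a * d = -(d * b) := by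
      ext1
      rw [Units.val_neg, Units.val_mul, Units.val_mul, hd, mul_sub, sub_mul, hab']
      abel
    have hdb : b * d = -(d * a) := by
      ext1
      rw [Units.val_neg, Units.val_mul, Units.val_mul, hd, mul_sub, sub_mul, hab']
      abel
    refine ⟨g⁻¹ * d, d * g, by group, Or.inr ⟨?_, ?_⟩⟩
    · rw [mul_assoc, ← neg_neg (d * a), ← hdb, hb]
      simp only [mul_neg, neg_mul]
      group
    · rw [mul_assoc, ← hbg, ← mul_assoc, neg_mul, ← mul_assoc, hda, neg_mul, neg_neg]
  · right
    refine ⟨1 - c ^ k, k, ?_, ?_, ?_, ?_, ?_, ?_⟩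
    · rw [mul_sub, sub_mul, sub_mul, hk]
      simp
    · exact fun h => h1 (sub_eq_zero.mp h).symm
    · exact fun h => h0 (by simpa using h)
    · exact (Commute.one_left _).sub_left (hac.pow_right k).symm
    · exact (Commute.one_left _).sub_left (hbc.pow_right k).symm
    · rw [sub_sub_cancel]

/-- **The cuspidal case.** Let `q` be an odd prime power, `G = GL_n(𝔽_q)`, and `A ∈ G` such
that conjugation by `A` is an involution of `G` (i.e. `A²` is a scalar matrix). Let `H_A` be the
centralizer of `A` in `G`. If `π` is a cuspidal irreducible complex representation of `G` with
a nonzero `H_A`-invariant vector, then `π ≅ π*`. -/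
theorem statement1 (q : ℕ) (hq : IsPrimePow q) (hqodd : Odd q)
    (F : Type) [Field F] [Fintype F] (hF : Fintype.card F = q)
    (n : ℕ) (A : GL (Fin n) F)
    (hA : ∃ c : F, ((A ^ 2 : GL (Fin n) F) : Matrix (Fin n) (Fin n) F) = c • 1)
    (V : Type) [AddCommGroup V] [Module ℂ V] [FiniteDimensional ℂ V]
    (π : Representation ℂ (GL (Fin n) F) V) (hirr : IsIrred π) (hcusp : IsCuspidal π)
    (hdist : HasInvVec π (Subgroup.centralizer {A} : Set (GL (Fin n) F))) :
    RepIso π π.dual := by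
  have h2 : IsUnit (2 : Matrix (Fin n) (Fin n) F) := by
    have h2F : (2 : F) ≠ 0 := by
      intro h
      have hchar : ringChar F = 2 := CharP.ringChar_of_prime_eq_zero Nat.prime_two h
      have := FiniteField.even_card_of_char_two hchar
      rw [hF, Nat.odd_iff.mp hqodd] at this
      exact one_ne_zero this
    have h := (IsUnit.mk0 _ h2F).map (algebraMap F (Matrix (Fin n) (Fin n) F))
    rwa [map_ofNat] at h
  obtain ⟨c, hc⟩ := hA
  have hcen : ∀ x : Matrix (Fin n) (Fin n) F, (A : Matrix (Fin n) (Fin n) F) * A * x =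
      x * ((A : Matrix (Fin n) (Fin n) F) * A) := by
    intro x
    rw [← Units.val_mul, ← pow_two, hc]
    simp
  obtain ⟨v, hv, hfix, ε, hε⟩ := exists_sign_eigenvector π A hdist
  obtain ⟨ℓ, hℓv, hℓ⟩ := exists_eigenfunctional π (signCentralizer A) v hv (by
    rintro g (hg | hg)
    · exact ⟨1, by rw [hfix g hg, one_smul]⟩
    · exact ⟨ε, hε g hg⟩)
  have hℓfix : ∀ g, g * A = A * g → ∀ x, ℓ (π g x) = ℓ x := by
    intro g hg x
    rw [hℓ g (Or.inl hg) 1 (by rw [hfix g hg, one_smul]), one_mul]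
  have hdichotomy : ∀ g, ℓ (π g⁻¹ v) = ℓ (π g v) ∨ ℓ (π g v) = 0 := by
    intro g
    rcases inv_eq_or_exists_idempotent h2 A g hcen with
      ⟨s, t, hst, hs⟩ | ⟨e, k, he, he0, he1, hea, heb, hk⟩
    · left
      rcases hs with ⟨hs, ht⟩ | ⟨hs, ht⟩
      · have htv : π t⁻¹ v = v := by
          nth_rw 1 [← hfix t ht]
          simp
        rw [hst, map_mul, map_mul, Module.End.mul_apply, Module.End.mul_apply, htv, hℓfix s hs]
      · have htv : ε • π t⁻¹ v = v := by
          rw [← map_smul, ← hε t ht]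
          simp
        rw [hst, map_mul, map_mul, Module.End.mul_apply, Module.End.mul_apply,
          hℓ s (Or.inr hs) ε (hε s hs), ← smul_eq_mul, ← map_smul, ← map_smul, htv]
    · right
      refine eq_zero_of_constant_on_orbit π (idemUnipotent e he)
        (hcusp.eq_zero_of_forall_idemUnipotent e he he0 he1) ℓ _ fun u hu => ?_
      have hab : A * A = g * A * g⁻¹ * (g * A * g⁻¹) := by
        have h : A * A * g = g * (A * A) := Units.ext (hcen g)
        calc A * A = A * A * g * g⁻¹ := by group
          _ = g * (A * A) * g⁻¹ := by rw [h]
          _ = _ := by group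
      obtain ⟨y, z, hy, hz, hyz, hAy, hBz⟩ :=
        exists_add_commute A (g * A * g⁻¹) e he hab hcen hea heb k hk _ hu
      have hmul : ∀ p q : Matrix (Fin n) (Fin n) F, e * p * (1 - e) = p → e * q * (1 - e) = q →
          p * q = 0 := by
        intro p q hp hq'
        have h1 : (1 - e) * e = 0 := by rw [sub_mul, one_mul, he, sub_self]
        calc p * q = e * p * ((1 - e) * e) * (q * (1 - e)) := by
              nth_rw 1 [← hp, ← hq']
              simp only [mul_assoc]
          _ = 0 := by rw [h1, mul_zero, zero_mul]
      have hu' : u = oneAddUnit y (hmul y y hy hy) * oneAddUnit z (hmul z z hz hz) := by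
        ext1
        change (u : Matrix (Fin n) (Fin n) F) = (1 + y) * (1 + z)
        rw [mul_add, mul_one, add_mul, hmul y z hy hz, one_mul, add_zero, add_assoc, ← hyz]
        abel
      have hyA : oneAddUnit y (hmul y y hy hy) * A = A * oneAddUnit y (hmul y y hy hy) :=
        Units.ext ((Commute.one_right _).add_right hAy).eq.symm
      have hzB : oneAddUnit z (hmul z z hz hz) * (g * A * g⁻¹) =
          g * A * g⁻¹ * oneAddUnit z (hmul z z hz hz) :=
        Units.ext ((Commute.one_right _).add_right hBz).eq.symm
      have hzv : π (oneAddUnit z (hmul z z hz hz)) (π g v) = π g v := by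
        have hconj : g⁻¹ * oneAddUnit z (hmul z z hz hz) * g * A =
            A * (g⁻¹ * oneAddUnit z (hmul z z hz hz) * g) := by
          calc g⁻¹ * oneAddUnit z (hmul z z hz hz) * g * A
              = g⁻¹ * (oneAddUnit z (hmul z z hz hz) * (g * A * g⁻¹)) * g := by group
            _ = A * (g⁻¹ * oneAddUnit z (hmul z z hz hz) * g) := by rw [hzB]; group
        have h := congrArg (π g) (hfix _ hconj)
        rw [← Module.End.mul_apply, ← map_mul] at h ⊢
        rw [← h]
        congr 2
        group
      rw [hu', map_mul, Module.End.mul_apply, hzv, hℓfix _ hyA]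
  refine repIso_dual_of_symmetric_coefficient π hirr v ℓ hℓv fun g => ?_
  rcases hdichotomy g with h | h
  · exact h
  · rcases hdichotomy g⁻¹ with h' | h'
    · rw [inv_inv] at h'
      exact h'.symm
    · rw [h, h']

end Paper
end
end

section
/- Let G be a finite group, P and H subgroups of G, and x a finite-dimensional complex representation of P. If the induced representation Ind_P^G x has a nonzero H-invariant vector, then there exists g ∈ G such that x has a nonzero vector invariant under the subgroup P ∩ gHg⁻¹. -/
open Matrix

noncomputable section

namespace Paper

variable {F : Type*} [Field F] {n m k : ℕ}

open scoped TensorProduct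

variable {G : Type*} [Group G] {W : Type*} [AddCommGroup W] [Module ℂ W]

variable {V : Type*} [AddCommGroup V] [Module ℂ V]

/-- **Mackey-type claim.** Let `G` be a finite group, `P, H ≤ G`, and `x` a finite-dimensional
complex representation of `P`. If `Ind_P^G x` has a nonzero `H`-invariant vector, then there
is `g ∈ G` such that `x` has a nonzero vector invariant under `P ∩ gHg⁻¹`. -/
theorem statement4 (G : Type) [Group G] [Fintype G] (P H : Subgroup G)
    (W : Type) [AddCommGroup W] [Module ℂ W] [FiniteDimensional ℂ W]
    (x : Representation ℂ P W)
    (hdist : HasInvVec (IndRep P x) (H : Set G)) :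
    ∃ g : G, ∃ v : W, v ≠ 0 ∧
      ∀ q : P, (∃ h ∈ H, (q : G) = g * h * g⁻¹) → x q v = v := by
  obtain ⟨φ, hφ, hinv⟩ := hdist
  obtain ⟨g, hg⟩ : ∃ g, (φ : G → W) g ≠ 0 :=
    Function.ne_iff.mp fun h => hφ (Subtype.ext h)
  refine ⟨g, (φ : G → W) g, hg, ?_⟩
  rintro q ⟨h, hh, hq⟩
  have translate : (φ : G → W) (g * h) = (φ : G → W) g :=
    congrArg (fun ψ : IndCarrier P x => (ψ : G → W) g) (hinv h hh)
  rw [← φ.2 q g, hq, inv_mul_cancel_right, translate]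

end Paper
end
end

section
/- Let q be an odd prime power and G = GL_n(𝔽_q). Let A ∈ G normalize the diagonal torus and satisfy that conjugation σ_A by A is an involution; let H = H_A be the centralizer of A. Let T = (T₀,…,T_{m-1}) be an ordered partition of the index set {0,…,n-1}, with associated function f_T: {0,…,n-1} → {0,…,m-1} sending T_a to a, let P(T), U(T), L(T) be the corresponding parabolic, unipotent radical and Levi subgroup, and let π_a be a representation of GL_{|T_a|}(𝔽_q) for each a. If the parabolic induction π = ∏_a π_a is H-distinguished, then there exists A′ ∈ G normalizing the diagonal torus, with σ_{A′} (conjugation by A′) an involution and induced index permutation τ_{A′}, such that, setting T_{a,b} = {i ∈ T_a : f_T(τ_{A′}(i)) = b}, the representation ⊠_a r_{T_{a,•}}(π_a) of the Levi subgroup L({T_{a,b}}) (the exterior tensor product over a of the Jacquet restrictions of π_a to the partition (T_{a,b})_b of T_a) has a nonzero vector invariant under the subgroup of elements of L({T_{a,b}}) fixed by σ_{A′}. -/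
open Matrix

noncomputable section

namespace Paper

variable {F : Type*} [Field F] {n m k : ℕ}

open scoped TensorProduct

variable {G : Type*} [Group G] {W : Type*} [AddCommGroup W] [Module ℂ W]

variable {V : Type*} [AddCommGroup V] [Module ℂ V]

/-- `π` occurs as a subrepresentation of `ξ`. -/
def OccursIn {G V W : Type*} [Group G] [AddCommGroup V] [Module ℂ V]
    [AddCommGroup W] [Module ℂ W]
    (π : Representation ℂ G V) (ξ : Representation ℂ G W) : Prop :=
  ∃ ι : V →ₗ[ℂ] W, Function.Injective ι ∧ ∀ (g : G) (v : V), ι (π g v) = ξ g (ι v)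

/-- the canonical identification `GL_a(F) ≅ GL_b(F)` for `a = b`. -/
def castGL {F : Type*} [Field F] {a b : ℕ} (h : a = b) : GL (Fin a) F ≃* GL (Fin b) F :=
  Units.mapEquiv (Matrix.reindexAlgEquiv F F (finCongr h)).toRingEquiv.toMulEquiv

/-- `π` is a `ρ`-primary representation: it occurs in the `c`-fold parabolic
induction `ρ × ρ × ⋯ × ρ`. -/
def IsPrimary {F : Type*} [Field F] {r c : ℕ} {V W : Type*}
    [AddCommGroup V] [Module ℂ V] [AddCommGroup W] [Module ℂ W]
    (ρ : Representation ℂ (GL (Fin r) F) V)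
    (π : Representation ℂ (GL (Fin (r * c)) F) W) : Prop :=
  ∃ (f : Fin (r * c) → Fin c) (e : ∀ _ : Fin c, Fin r → Fin (r * c))
    (_ : Monotone f) (he : ∀ a, StrictMono (e a))
    (hmem : ∀ a i, f (e a i) = a) (hsurj : ∀ a j, f j = a → ∃ i, e a i = j),
    OccursIn π (parabolicInd f e (fun a => (he a).injective) hmem hsurj (fun _ => ρ))

section Statement5

variable {F : Type*} [Field F]

/-- the refined partition function `i ↦ (f i, f (τ i))`. -/
def refinedF {n m : ℕ} (f : Fin n → Fin m) (τ : Equiv.Perm (Fin n)) : Fin n → Fin (m * m) :=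
  fun i => finProdFinEquiv (f i, f (τ i))

theorem refinedF_inj {n m : ℕ} {f : Fin n → Fin m} {τ : Equiv.Perm (Fin n)} {i j : Fin n}
    (h : refinedF f τ i = refinedF f τ j) : f i = f j ∧ f (τ i) = f (τ j) := by
  have h2 := finProdFinEquiv.injective h
  exact ⟨congrArg Prod.fst h2, congrArg Prod.snd h2⟩

theorem levi_refined_le_parabolic {n m : ℕ} (f : Fin n → Fin m) (τ : Equiv.Perm (Fin n)) :
    levi (F := F) (refinedF f τ) ≤ parabolic f := by
  intro A hA
  intro i j hlt
  apply (levi_mem'.mp hA) i j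
  intro hc
  exact (ne_of_lt hlt) (refinedF_inj hc).1.symm

theorem block_mem_levi {n m : ℕ} (f : Fin n → Fin m) (τ : Equiv.Perm (Fin n)) (a : Fin m)
    {k : ℕ} (e : Fin k → Fin n) (he : Function.Injective e) (hmem : ∀ i, f (e i) = a)
    (hsurj : ∀ j, f j = a → ∃ i, e i = j) (l : levi (F := F) (refinedF f τ)) :
    (leviProj f a e he hmem hsurj)
        (Subgroup.inclusion (levi_refined_le_parabolic f τ) l)
      ∈ levi (F := F) (fun i => f (τ (e i))) := by
  intro i j hij
  show ((l : GL (Fin n) F) : Matrix (Fin n) (Fin n) F) (e i) (e j) = 0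
  apply (levi_mem'.mp l.2) (e i) (e j)
  intro hc
  exact hij (refinedF_inj hc).2

/-- the homomorphism from the refined Levi subgroup of `GL_n` to the Levi subgroup of the
`a`-th block `GL_{k a}` given by extracting the `a`-th diagonal block. -/
def toLeviBlock {n m : ℕ} (f : Fin n → Fin m) (τ : Equiv.Perm (Fin n)) (a : Fin m)
    {k : ℕ} (e : Fin k → Fin n) (he : Function.Injective e) (hmem : ∀ i, f (e i) = a)
    (hsurj : ∀ j, f j = a → ∃ i, e i = j) :
    (levi (F := F) (refinedF f τ)) →* (levi (F := F) (fun i : Fin k => f (τ (e i)))) :=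
  MonoidHom.codRestrict
    ((leviProj f a e he hmem hsurj).comp (Subgroup.inclusion (levi_refined_le_parabolic f τ)))
    _ (block_mem_levi f τ a e he hmem hsurj)

/-- the exterior tensor product of the Jacquet restrictions `⊠_a r_{T_{a,•}}(π_a)` as a
representation of the refined Levi subgroup `L({T_{a,b}})`. -/
def jacquetTensorRep {n m : ℕ} (f : Fin n → Fin m) {k : Fin m → ℕ}
    (e : ∀ a, Fin (k a) → Fin n) (he : ∀ a, Function.Injective (e a))
    (hmem : ∀ a i, f (e a i) = a) (hsurj : ∀ a j, f j = a → ∃ i, e a i = j)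
    {V : Fin m → Type*} [∀ a, AddCommGroup (V a)] [∀ a, Module ℂ (V a)]
    (π : ∀ a, Representation ℂ (GL (Fin (k a)) F) (V a)) (τ : Equiv.Perm (Fin n)) :
    Representation ℂ (levi (F := F) (refinedF f τ))
      (⨂[ℂ] a, jacquetModule (π a) (fun i => f (τ (e a i)))) :=
  (piTensorRep (fun a => jacquetRep (π a) (fun i => f (τ (e a i))))).comp
    (Pi.monoidHom (fun a => toLeviBlock f τ a (e a) (he a) (hmem a) (hsurj a)))

end Statement5

section TriangularMonomial

variable {F : Type*} [Field F] {ι : Type*}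

/-- `i` is the index of largest rank (with respect to `r`) in the support of `v`. -/
def HasLevel (r : ι → ℕ) (v : ι → F) (i : ι) : Prop :=
  v i ≠ 0 ∧ ∀ j, r i < r j → v j = 0

theorem exists_hasLevel [Fintype ι] (r : ι → ℕ) {v : ι → F} (hv : v ≠ 0) :
    ∃ i, HasLevel r v i := by
  classical
  obtain ⟨i₀, hi₀⟩ := Function.ne_iff.mp hv
  obtain ⟨i, hi, hmax⟩ := (Finset.univ.filter fun i => v i ≠ 0).exists_max_image r
    ⟨i₀, by simpa using hi₀⟩
  refine ⟨i, by simpa using hi, fun j hj => ?_⟩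
  by_contra h
  exact absurd (hmax j (by simpa using h)) (not_le.mpr hj)

theorem HasLevel.smul {r : ι → ℕ} {v : ι → F} {i : ι} (h : HasLevel r v i) {c : F}
    (hc : c ≠ 0) : HasLevel r (c • v) i :=
  ⟨mul_ne_zero hc h.1, fun j hj => by simp [h.2 j hj]⟩

theorem det_ne_zero_of_hasLevel_col [Fintype ι] [DecidableEq ι] {r : ι → ℕ}
    (hr : Function.Injective r) {Q : Matrix ι ι F} (hQ : ∀ j, HasLevel r (Qᵀ j) j) :
    Q.det ≠ 0 := by
  intro h
  obtain ⟨x, hx, hQx⟩ := Matrix.exists_mulVec_eq_zero_iff.mpr h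
  obtain ⟨i, hi, hmax⟩ := exists_hasLevel r hx
  have h1 := congrFun hQx i
  rw [Matrix.mulVec, dotProduct, Finset.sum_eq_single i] at h1
  · exact mul_ne_zero (hQ i).1 hi h1
  · intro j _ hj
    rcases lt_or_gt_of_ne (hr.ne hj) with h | h
    · rw [show Q i j = 0 from (hQ j).2 i h, zero_mul]
    · rw [hmax j h, mul_zero]
  · simp

/-- A matrix whose square is a nonzero scalar is conjugate to a monomial matrix by a matrix
which is triangular with respect to any prescribed ordering of the basis. -/
theorem exists_triangular_conj_monomial [Fintype ι] [DecidableEq ι] {r : ι → ℕ}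
    (hr : Function.Injective r) (h2 : (2 : F) ≠ 0) {B : Matrix ι ι F} {c : F} (hc : c ≠ 0)
    (hB : ∀ v, B *ᵥ (B *ᵥ v) = c • v) :
    ∃ (Q : Matrix ι ι F) (τ : Equiv.Perm ι) (d : ι → F), (∀ j, HasLevel r (Qᵀ j) j) ∧
      ∀ j, B *ᵥ (Qᵀ j) = d j • Qᵀ (τ j) := by
  classical
  have hinj : ∀ v, v ≠ 0 → B *ᵥ v ≠ 0 := by
    intro v hv h
    have := hB v
    rw [h, Matrix.mulVec_zero] at this
    exact smul_ne_zero hc hv this.symm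
  have hex : ∀ i, ∃ j v, HasLevel r v i ∧ HasLevel r (B *ᵥ v) j ∧
      ∀ u k, HasLevel r u i → HasLevel r (B *ᵥ u) k → r j ≤ r k := by
    intro i
    let S := Finset.univ.filter fun j => ∃ v, HasLevel r v i ∧ HasLevel r (B *ᵥ v) j
    have hi : HasLevel r (Pi.single i (1 : F)) i :=
      ⟨by simp, fun j hj => by
        rw [Pi.single_eq_of_ne]; rintro rfl; exact lt_irrefl _ hj⟩
    have hS : S.Nonempty := by
      obtain ⟨j, hj⟩ := exists_hasLevel r
        (hinj (Pi.single i (1 : F)) (fun h => hi.1 (congrFun h i)))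
      exact ⟨j, by simpa [S] using ⟨_, hi, hj⟩⟩
    obtain ⟨j, hj, hmin⟩ := S.exists_min_image r hS
    obtain ⟨v, hv, hBv⟩ := (Finset.mem_filter.mp hj).2
    exact ⟨j, v, hv, hBv, fun u k hu hk => hmin k (by simpa [S] using ⟨u, hu, hk⟩)⟩
  choose w v hv hBv hmin using hex
  have not_below : ∀ i u, HasLevel r u i → (∀ k, r (w i) ≤ r k → (B *ᵥ u) k = 0) → False := by
    intro i u hu hbelow
    obtain ⟨j, hj⟩ := exists_hasLevel r (hinj u (fun h => hu.1 (congrFun h i)))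
    exact hj.1 (hbelow j (hmin i u j hu hj))
  have hww : ∀ i, w (w i) = i := by
    intro i
    have hle : r (w (w i)) ≤ r i := by
      refine hmin (w i) (B *ᵥ v i) i (hBv i) ?_
      rw [hB]
      exact (hv i).smul hc
    by_contra hne
    have hlt : r (w (w i)) < r i := lt_of_le_of_ne hle (hr.ne hne)
    set α := (B *ᵥ v i) (w i) / v (w i) (w i) with hα
    have hlow : ∀ k, r i ≤ r k → (B *ᵥ v (w i)) k = 0 :=
      fun k hk => (hBv (w i)).2 k (hlt.trans_le hk)
    refine not_below i (v i - (α / c) • (B *ᵥ v (w i))) ⟨?_, ?_⟩ ?_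
    · simpa [hlow i le_rfl] using (hv i).1
    · intro j hj
      simp [hlow j hj.le, (hv i).2 j hj]
    · intro k hk
      rw [Matrix.mulVec_sub, Matrix.mulVec_smul, hB, smul_smul, div_mul_cancel₀ _ hc]
      rcases hk.eq_or_lt with hk | hk
      · have hk : w i = k := hr hk
        subst hk
        simp [hα, div_mul_cancel₀ _ (hv (w i)).1]
      · simp [(hBv i).2 k hk, (hv (w i)).2 k hk]
  have heig : ∀ i, w i = i → ∃ (u : ι → F) (t : F), HasLevel r u i ∧ B *ᵥ u = t • u := by
    intro i hi
    have hBi := hBv i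
    rw [hi] at hBi
    have hxl := hv i
    have hxi := hxl.1
    set x := v i
    set t := (B *ᵥ x) i / x i with ht
    have hti : (B *ᵥ x) i = t * x i := by rw [ht, div_mul_cancel₀ _ hxi]
    have ht0 : t ≠ 0 := div_ne_zero hBi.1 hxi
    have htc : t * t = c := by
      by_contra hne
      have hne' : c - t * t ≠ 0 := sub_ne_zero.mpr (Ne.symm hne)
      refine not_below i (x - (t / (c - t * t)) • (B *ᵥ x - t • x)) ⟨?_, ?_⟩ ?_
      · simpa [hti] using hxi
      · intro j hj
        simp [hxl.2 j hj, hBi.2 j hj]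
      · intro k hk
        rw [hi] at hk
        simp only [Matrix.mulVec_sub, Matrix.mulVec_smul, hB, Pi.sub_apply, Pi.smul_apply,
          smul_eq_mul]
        rcases hk.eq_or_lt with hk | hk
        · have hk : i = k := hr hk
          subst hk
          rw [hti, show c * x i - t * (t * x i) = (c - t * t) * x i by ring, ← mul_assoc,
            div_mul_cancel₀ _ hne', sub_self]
        · rw [hBi.2 k hk, hxl.2 k hk]
          ring
    refine ⟨B *ᵥ x + t • x, t, ⟨?_, ?_⟩, ?_⟩
    · rw [Pi.add_apply, Pi.smul_apply, hti, smul_eq_mul, ← two_mul]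
      exact mul_ne_zero h2 (mul_ne_zero ht0 hxi)
    · intro j hj
      simp [hxl.2 j hj, hBi.2 j hj]
    · rw [Matrix.mulVec_add, Matrix.mulVec_smul, hB, smul_add, smul_smul, htc, add_comm]
  choose! u t hu hBu using heig
  let col : ι → ι → F := fun i =>
    if w i = i then u i else if r i < r (w i) then v i else B *ᵥ v (w i)
  let d : ι → F := fun i => if w i = i then t i else if r i < r (w i) then 1 else c
  refine ⟨(Matrix.of col)ᵀ, ⟨w, w, hww, hww⟩, d, fun j => ?_, fun j => ?_⟩
  · show HasLevel r (col j) j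
    by_cases h : w j = j
    · simpa [col, h] using hu j h
    · by_cases h' : r j < r (w j)
      · simpa [col, h, h'] using hv j
      · simpa [col, h, h', hww j] using hBv (w j)
  · show B *ᵥ col j = d j • col (w j)
    by_cases h : w j = j
    · simpa [col, d, h] using hBu j h
    · by_cases h' : r j < r (w j)
      · simp [col, d, h, h', hww j, Ne.symm h, h'.le]
      · have h'' : r (w j) < r j := lt_of_le_of_ne (not_lt.mp h') (hr.ne h)
        simp [col, d, h, h', h'', hww j, Ne.symm h, hB]

end TriangularMonomial

section BlockLift

variable {F : Type*} [Field F]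

theorem IsMonomialWith.apply_ne_zero {n : ℕ} {A : GL (Fin n) F} {σ : Equiv.Perm (Fin n)}
    (hA : IsMonomialWith A σ) (j : Fin n) : (A : Matrix (Fin n) (Fin n) F) (σ j) j ≠ 0 := by
  intro h
  refine (Matrix.GeneralLinearGroup.det A).ne_zero
    (Matrix.det_eq_zero_of_column_eq_zero j fun i => ?_)
  by_cases hi : i = σ j
  · rw [hi, h]
  · exact hA i j hi

/-- Conjugation by a monomial matrix permutes the support of a matrix. -/
theorem IsMonomialWith.apply_symm_ne_zero {n : ℕ} {A : GL (Fin n) F} {σ : Equiv.Perm (Fin n)}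
    (hA : IsMonomialWith A σ) {M N : Matrix (Fin n) (Fin n) F}
    (h : M * A = (A : Matrix (Fin n) (Fin n) F) * N) {i j : Fin n} (hij : M i j ≠ 0) :
    N (σ.symm i) (σ.symm j) ≠ 0 := by
  have h1 := congrFun (congrFun h i) (σ.symm j)
  rw [Matrix.mul_apply, Matrix.mul_apply, Finset.sum_eq_single j,
    Finset.sum_eq_single (σ.symm i)] at h1
  · intro h0
    rw [h0, mul_zero] at h1
    have h2 := hA.apply_ne_zero (σ.symm j)
    rw [σ.apply_symm_apply] at h2
    exact mul_ne_zero hij h2 h1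
  · intro s _ hs
    rw [hA i s (fun h => hs (by simp [h])), zero_mul]
  · simp
  · intro s _ hs
    rw [hA s _ (by simpa using hs), mul_zero]
  · simp

/-- A block-diagonal matrix `u` with unipotent blocks lifts to the element `u + σ(u) - 1` of the
parabolic subgroup, which is fixed by the involution `σ` of conjugation by `A`. -/
theorem exists_fixed_leviProj_eq {n m : ℕ} {f : Fin n → Fin m} {k : Fin m → ℕ}
    {e : ∀ a, Fin (k a) → Fin n} (he : ∀ a, Function.Injective (e a))
    (hmem : ∀ a i, f (e a i) = a) (hsurj : ∀ a j, f j = a → ∃ i, e a i = j)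
    {A : GL (Fin n) F} {τ : Equiv.Perm (Fin n)} (hA : IsMonomialWith A τ)
    (hA2 : A ^ 2 ∈ Subgroup.center (GL (Fin n) F)) (g : ∀ a, GL (Fin (k a)) F)
    (hg : ∀ a, unipMem (fun i => f (τ (e a i))) (g a : Matrix (Fin (k a)) (Fin (k a)) F)) :
    ∃ y : parabolic (F := F) f, A * (y : GL (Fin n) F) * A⁻¹ = y ∧
      ∀ a, leviProj f a (e a) (he a) (hmem a) (hsurj a) y = g a := by
  have hbij : Function.Bijective (fun x : Σ a, Fin (k a) => e x.1 x.2) := by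
    constructor
    · rintro ⟨a, i⟩ ⟨b, j⟩ h
      have hab : a = b := by rw [← hmem a i, ← hmem b j]; exact congrArg f h
      subst hab
      exact congrArg _ (he a h)
    · intro j
      obtain ⟨i, hi⟩ := hsurj (f j) j rfl
      exact ⟨⟨f j, i⟩, hi⟩
  let E := Equiv.ofBijective _ hbij
  let D : Matrix (Fin n) (Fin n) F := Matrix.reindex E E
    (Matrix.blockDiagonal' fun a => (g a : Matrix (Fin (k a)) (Fin (k a)) F))
  have hDdet : D.det ≠ 0 := by
    have hunit : IsUnit D :=
      ((Pi.isUnit_iff.mpr fun a => (g a).isUnit).map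
        (Matrix.blockDiagonal'RingHom (fun a => Fin (k a)) F)).map (Matrix.reindexAlgEquiv F F E)
    exact ((Matrix.isUnit_iff_isUnit_det D).mp hunit).ne_zero
  have hD : ∀ a b i j, D (e a i) (e b j) = Matrix.blockDiagonal'
      (fun a => (g a : Matrix (Fin (k a)) (Fin (k a)) F)) ⟨a, i⟩ ⟨b, j⟩ := by
    intro a b i j
    have h1 : E.symm (e a i) = ⟨a, i⟩ := E.symm_apply_apply ⟨a, i⟩
    have h2 : E.symm (e b j) = ⟨b, j⟩ := E.symm_apply_apply ⟨b, j⟩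
    simp only [D, Matrix.reindex_apply, Matrix.submatrix_apply, h1, h2]
  have hDsub : ∀ i j, (D - 1) i j ≠ 0 → f i = f j ∧ f (τ i) < f (τ j) := by
    intro i j hij
    obtain ⟨⟨a, s⟩, rfl⟩ := hbij.2 i
    obtain ⟨⟨b, t⟩, rfl⟩ := hbij.2 j
    simp only [hmem] at hij ⊢
    by_cases hab : a = b
    · subst hab
      refine ⟨rfl, ?_⟩
      by_contra hlt
      apply hij
      have := hg a s t hlt
      rw [Matrix.sub_apply, hD, Matrix.blockDiagonal'_apply_eq, this]
      simp [Matrix.one_apply, (he a).eq_iff]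
    · refine absurd ?_ hij
      have hne : e a s ≠ e b t := fun h => hab (by rw [← hmem a s, ← hmem b t, h])
      rw [Matrix.sub_apply, hD, Matrix.blockDiagonal'_apply_ne _ _ _ hab,
        Matrix.one_apply_ne hne, sub_zero]
  let u : GL (Fin n) F := Matrix.GeneralLinearGroup.mkOfDetNeZero D hDdet
  have hu : (u : Matrix (Fin n) (Fin n) F) = D := rfl
  let N : Matrix (Fin n) (Fin n) F := ((A * u * A⁻¹ : GL (Fin n) F) : Matrix _ _ F) - 1
  have hAA : (A : Matrix (Fin n) (Fin n) F) * ((A⁻¹ : GL (Fin n) F) : Matrix _ _ F) = 1 := by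
    rw [← Units.val_mul, mul_inv_cancel, Units.val_one]
  have hNA : N * A = (A : Matrix (Fin n) (Fin n) F) * (D - 1) := by
    rw [sub_mul, ← Units.val_mul, inv_mul_cancel_right, Units.val_mul, hu, mul_sub, one_mul,
      mul_one]
  have hN : ∀ i j, N i j ≠ 0 → f i < f j := by
    intro i j hij
    simpa using (hDsub _ _ (hA.apply_symm_ne_zero hNA hij)).2
  have hDtri : BlockTriangular D f := by
    intro i j hij
    by_contra h
    have hne : i ≠ j := by rintro rfl; exact lt_irrefl _ hij
    have := hDsub i j (by simpa [Matrix.one_apply_ne hne] using h)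
    exact hij.ne' this.1
  have hYtri : BlockTriangular (D + N) f := by
    refine hDtri.add fun i j hij => ?_
    by_contra h
    exact lt_asymm hij (hN i j h)
  have hYdet : (D + N).det ≠ 0 := by
    have : (D + N).det = D.det := by
      rw [hYtri.det, hDtri.det]
      refine Finset.prod_congr rfl fun a _ => ?_
      congr 1
      ext i j
      have : N i j = 0 := by
        by_contra h
        exact absurd (hN _ _ h) (by rw [i.2, j.2]; exact lt_irrefl _)
      simp [Matrix.toSquareBlock_def, this]
    rwa [this]
  let y : GL (Fin n) F := Matrix.GeneralLinearGroup.mkOfDetNeZero (D + N) hYdet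
  have hy : (y : Matrix (Fin n) (Fin n) F) = D + N := rfl
  refine ⟨⟨y, hYtri⟩, ?_, fun a => ?_⟩
  · have h2 : A * (A * u * A⁻¹) * A⁻¹ = u := by
      have := Subgroup.mem_center_iff.mp hA2 u
      calc A * (A * u * A⁻¹) * A⁻¹ = A ^ 2 * u * (A ^ 2)⁻¹ := by
            simp only [sq, _root_.mul_inv_rev, mul_assoc]
        _ = u := by rw [← this, mul_inv_cancel_right]
    have h3 := congrArg (fun x : GL (Fin n) F => (x : Matrix (Fin n) (Fin n) F)) h2
    apply Units.ext
    simp only [Units.val_mul] at h3 ⊢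
    rw [hy]
    simp only [N, Units.val_mul]
    rw [mul_add, add_mul, mul_sub, sub_mul, h3, mul_one, hAA, hu]
    abel
  · ext i j
    show (D + N) (e a i) (e a j) = _
    have : N (e a i) (e a j) = 0 := by
      by_contra h
      exact absurd (hN _ _ h) (by rw [hmem, hmem]; exact lt_irrefl _)
    rw [Matrix.add_apply, this, add_zero, hD, Matrix.blockDiagonal'_apply_eq]

end BlockLift

section Average

variable {F : Type*} [Field F]

/-- The unipotent radical attached to a partition function `f`. -/
def unipSubgroup {n m : ℕ} (f : Fin n → Fin m) : Subgroup (GL (Fin n) F) where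
  carrier := {A | unipMem f (A : Matrix (Fin n) (Fin n) F)}
  one_mem' := fun _ _ _ => rfl
  mul_mem' := by
    intro A B hA hB i j hij
    have h : ((A * B : GL (Fin n) F) : Matrix (Fin n) (Fin n) F)
        = 1 + (A - 1 : Matrix (Fin n) (Fin n) F) + (B - 1 : Matrix (Fin n) (Fin n) F)
          + (A - 1 : Matrix (Fin n) (Fin n) F) * (B - 1 : Matrix (Fin n) (Fin n) F) := by
      rw [Units.val_mul]
      noncomm_ring
    rw [h, Matrix.add_apply, Matrix.add_apply, Matrix.add_apply, Matrix.sub_apply,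
      Matrix.sub_apply, hA i j hij, hB i j hij, Matrix.mul_apply, Finset.sum_eq_zero]
    · ring
    · intro s _
      by_cases hs : f i < f s
      · rw [Matrix.sub_apply _ _ s j, hB s j (fun h => hij (hs.trans h)), sub_self, mul_zero]
      · rw [Matrix.sub_apply _ _ i s, hA i s hs, sub_self, zero_mul]
  inv_mem' := by
    intro A hA i j hij
    have htri : A ∈ parabolic (F := F) f := by
      intro i j hij
      rw [hA i j hij.asymm, Matrix.one_apply_ne]
      rintro rfl
      exact lt_irrefl _ hij
    have htri' := parabolic_mem'.mp ((parabolic f).inv_mem htri)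
    have h : ((A⁻¹ : GL (Fin n) F) : Matrix (Fin n) (Fin n) F)
        = 1 - (A - 1 : Matrix (Fin n) (Fin n) F) * ((A⁻¹ : GL (Fin n) F) : Matrix _ _ F) := by
      rw [sub_mul, ← Units.val_mul, mul_inv_cancel, Units.val_one]
      noncomm_ring
    rw [h, Matrix.sub_apply, Matrix.mul_apply, Finset.sum_eq_zero, sub_zero]
    intro s _
    by_cases hs : f i < f s
    · rw [htri' (lt_of_le_of_lt (not_lt.mp hij) hs), mul_zero]
    · rw [Matrix.sub_apply _ _ i s, hA i s hs, sub_self, zero_mul]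

/-- The average of a representation over a subgroup. -/
def subgroupAverage {G V : Type*} [Group G] [AddCommGroup V] [Module ℂ V]
    (π : Representation ℂ G V) (U : Subgroup G) [Fintype U] : V →ₗ[ℂ] V :=
  (Fintype.card U : ℂ)⁻¹ • ∑ u : U, π u

theorem apply_subgroupAverage {G V : Type*} [Group G] [AddCommGroup V] [Module ℂ V]
    (π : Representation ℂ G V) (U : Subgroup G) [Fintype U] {u : G} (hu : u ∈ U) (v : V) :
    π u (subgroupAverage π U v) = subgroupAverage π U v := by
  simp only [subgroupAverage, LinearMap.smul_apply, LinearMap.sum_apply, map_smul, map_sum]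
  congr 1
  refine Fintype.sum_equiv (Equiv.mulLeft (⟨u, hu⟩ : U)) _ _ fun x => ?_
  simp [map_mul]

theorem subgroupAverage_apply_of_invariant {G V : Type*} [Group G] [AddCommGroup V] [Module ℂ V]
    (π : Representation ℂ G V) (U : Subgroup G) [Fintype U] {v : V}
    (hv : ∀ u ∈ U, π u v = v) : subgroupAverage π U v = v := by
  simp only [subgroupAverage, LinearMap.smul_apply, LinearMap.sum_apply]
  rw [Finset.sum_congr rfl fun (u : U) _ => hv u u.2, Finset.sum_const, Finset.card_univ,
    ← Nat.cast_smul_eq_nsmul ℂ, smul_smul, inv_mul_cancel₀ (by simp), one_smul]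

open scoped TensorProduct in
/-- A vector of an exterior tensor product invariant under a product of subgroups is fixed by the
tensor product of the averages. -/
theorem map_subgroupAverage_of_invariant {ι : Type*} [Fintype ι] {G : ι → Type*}
    [∀ a, Group (G a)] {V : ι → Type*} [∀ a, AddCommGroup (V a)] [∀ a, Module ℂ (V a)]
    (π : ∀ a, Representation ℂ (G a) (V a)) (U : ∀ a, Subgroup (G a)) [∀ a, Fintype (U a)]
    {v : ⨂[ℂ] a, V a} (hv : ∀ g : ∀ a, G a, (∀ a, g a ∈ U a) → piTensorRep π g v = v) :
    PiTensorProduct.map (fun a => subgroupAverage (π a) (U a)) v = v := by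
  classical
  have h : PiTensorProduct.map (fun a => subgroupAverage (π a) (U a))
      = (∏ a, (Fintype.card (U a) : ℂ)⁻¹) • ∑ r : ∀ a, U a,
        piTensorRep π (fun a => (r a : G a)) := by
    have := (PiTensorProduct.mapMultilinear ℂ V V).map_smul_univ
      (fun a => (Fintype.card (U a) : ℂ)⁻¹) (fun a => ∑ u : U a, π a u)
    rw [MultilinearMap.map_sum] at this
    exact this
  rw [h, LinearMap.smul_apply, LinearMap.sum_apply,
    Finset.sum_congr rfl fun r _ => hv (fun a => (r a : G a)) fun a => (r a).2, Finset.sum_const,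
    Finset.card_univ, Fintype.card_pi, ← Nat.cast_smul_eq_nsmul ℂ, smul_smul, Nat.cast_prod,
    ← Finset.prod_mul_distrib, Finset.prod_eq_one, one_smul]
  intro a _
  exact inv_mul_cancel₀ (by simp)

end Average

open scoped TensorProduct in
/-- Invariants of the exterior tensor product under the `σ`-fixed points of the parabolic subgroup,
`σ` being conjugation by a monomial matrix, give invariants of the exterior tensor product of the
Jacquet restrictions. -/
theorem hasInvVec_jacquetTensorRep {F : Type*} [Field F] [Finite F] {n m : ℕ} {f : Fin n → Fin m}
    {k : Fin m → ℕ} {e : ∀ a, Fin (k a) → Fin n} (he : ∀ a, Function.Injective (e a))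
    (hmem : ∀ a i, f (e a i) = a) (hsurj : ∀ a j, f j = a → ∃ i, e a i = j)
    {V : Fin m → Type*} [∀ a, AddCommGroup (V a)] [∀ a, Module ℂ (V a)]
    (π : ∀ a, Representation ℂ (GL (Fin (k a)) F) (V a))
    {A : GL (Fin n) F} {τ : Equiv.Perm (Fin n)} (hA : IsMonomialWith A τ)
    (hA2 : A ^ 2 ∈ Subgroup.center (GL (Fin n) F))
    (h : HasInvVec ((piTensorRep π).comp (leviProjPi f e he hmem hsurj))
      {p | A * (p : GL (Fin n) F) * A⁻¹ = p}) :
    HasInvVec (jacquetTensorRep f e he hmem hsurj π τ)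
      {l | A * (l : GL (Fin n) F) * A⁻¹ = l} := by
  classical
  obtain ⟨v, hv0, hv⟩ := h
  let φ : ∀ a, Fin (k a) → Fin m := fun a i => f (τ (e a i))
  let U : ∀ a, Subgroup (GL (Fin (k a)) F) := fun a => unipSubgroup (φ a)
  have : ∀ a, Fintype (U a) := fun a => Fintype.ofFinite _
  have hmap := map_subgroupAverage_of_invariant π U (v := v) (by
    intro g hg
    obtain ⟨y, hy, hyg⟩ := exists_fixed_leviProj_eq he hmem hsurj hA hA2 g hg
    rw [← show leviProjPi f e he hmem hsurj y = g from funext hyg]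
    exact hv y hy)
  let incl : ∀ a, jacquetModule (π a) (φ a) →ₗ[ℂ] V a :=
    fun a => (jacquetModule (π a) (φ a)).subtype
  let proj : ∀ a, V a →ₗ[ℂ] jacquetModule (π a) (φ a) := fun a =>
    (subgroupAverage (π a) (U a)).codRestrict _
      fun w u hu => apply_subgroupAverage (π a) (U a) hu w
  have hincl : PiTensorProduct.map incl (PiTensorProduct.map proj v) = v := by
    rw [← LinearMap.comp_apply, ← PiTensorProduct.map_comp]
    exact hmap
  have hproj : ∀ w, PiTensorProduct.map proj (PiTensorProduct.map incl w) = w := by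
    intro w
    have hid : ∀ a, proj a ∘ₗ incl a = LinearMap.id := fun a =>
      LinearMap.ext fun x => Subtype.ext
        (subgroupAverage_apply_of_invariant (π a) (U a) fun u hu => x.2 u hu)
    rw [← LinearMap.comp_apply, ← PiTensorProduct.map_comp, funext hid, PiTensorProduct.map_id,
      LinearMap.id_apply]
  refine ⟨PiTensorProduct.map proj v, fun h0 => hv0 ?_, fun l hl => ?_⟩
  · rw [← hincl, h0, map_zero]
  · let p : parabolic (F := F) f := Subgroup.inclusion (levi_refined_le_parabolic f τ) l
    have hequiv : ∀ w, PiTensorProduct.map incl (jacquetTensorRep f e he hmem hsurj π τ l w)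
        = piTensorRep π (leviProjPi f e he hmem hsurj p) (PiTensorProduct.map incl w) := by
      intro w
      show PiTensorProduct.map incl (PiTensorProduct.map _ w)
        = PiTensorProduct.map _ (PiTensorProduct.map incl w)
      rw [← LinearMap.comp_apply, ← PiTensorProduct.map_comp, ← LinearMap.comp_apply,
        ← PiTensorProduct.map_comp]
      rfl
    rw [← hproj (jacquetTensorRep f e he hmem hsurj π τ l _), hequiv, hincl]
    exact congrArg _ (hv p hl)

/-- An element of `GL_n` with central square is conjugate by an element of a given standard
parabolic subgroup to a monomial matrix. -/
theorem exists_parabolic_conj_monomial {F : Type*} [Field F] (h2 : (2 : F) ≠ 0) {n m : ℕ}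
    (f : Fin n → Fin m) (B : GL (Fin n) F) (hB : B ^ 2 ∈ Subgroup.center (GL (Fin n) F)) :
    ∃ Q ∈ parabolic (F := F) f, ∃ τ, IsMonomialWith (Q⁻¹ * B * Q) τ := by
  rcases n.eq_zero_or_pos with rfl | hn
  · exact ⟨1, one_mem _, 1, fun i => i.elim0⟩
  obtain ⟨c, hc⟩ := Matrix.GeneralLinearGroup.mem_center_iff_val_mem_range_scalar.mp hB
  have hBB : (B : Matrix (Fin n) (Fin n) F) * B = Matrix.scalar (Fin n) c := by
    rw [hc, sq, Units.val_mul]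
  have hc0 : c ≠ 0 := by
    rintro rfl
    rw [map_zero] at hc
    have : Nonempty (Fin n) := ⟨⟨0, hn⟩⟩
    exact (B ^ 2).ne_zero hc.symm
  let r : Fin n → ℕ := fun i => i + n * f i
  have hmod : ∀ i, r i % n = i := fun i => by
    simp [r, Nat.add_mul_mod_self_left, Nat.mod_eq_of_lt i.2]
  have hr : Function.Injective r := fun i j hij => by
    apply Fin.ext
    rw [← hmod i, ← hmod j, hij]
  have hrf : ∀ i j, f i < f j → r i < r j := fun i j hij => by
    have h1 : n * ((f i : ℕ) + 1) ≤ n * (f j : ℕ) := Nat.mul_le_mul_left n hij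
    have h3 := i.2
    simp only [r]
    rw [mul_add] at h1
    omega
  obtain ⟨Q, τ, d, hQ, hBQ⟩ := exists_triangular_conj_monomial hr h2
    (B := (B : Matrix (Fin n) (Fin n) F)) hc0 (fun v => by
      rw [Matrix.mulVec_mulVec, hBB, Matrix.scalar_apply, ← Matrix.smul_one_eq_diagonal,
        Matrix.smul_mulVec, Matrix.one_mulVec])
  let Q' : GL (Fin n) F :=
    Matrix.GeneralLinearGroup.mkOfDetNeZero Q (det_ne_zero_of_hasLevel_col hr hQ)
  refine ⟨Q', fun i j hij => (hQ j).2 i (hrf j i hij), τ, fun i j hij => ?_⟩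
  have hcol : ∀ j, (Q'⁻¹ : GL (Fin n) F).val *ᵥ Qᵀ j = Pi.single j 1 := by
    intro j
    have hQj : Qᵀ j = Q'.val *ᵥ Pi.single j 1 := by
      rw [Matrix.mulVec_single_one]; rfl
    rw [hQj, Matrix.mulVec_mulVec, ← Units.val_mul, inv_mul_cancel, Units.val_one,
      Matrix.one_mulVec]
  have hval : ((Q'⁻¹ * B * Q' : GL (Fin n) F) : Matrix (Fin n) (Fin n) F) *ᵥ Pi.single j 1
      = d j • Pi.single (τ j) 1 := by
    rw [Units.val_mul, Units.val_mul, ← Matrix.mulVec_mulVec, ← Matrix.mulVec_mulVec,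
      Matrix.mulVec_single_one]
    change _ *ᵥ (_ *ᵥ Qᵀ j) = _
    rw [hBQ, Matrix.mulVec_smul, hcol]
  have := congrFun hval i
  rw [Matrix.mulVec_single_one] at this
  simpa [hij] using this

open scoped TensorProduct in
/-- **The geometric lemma / distinguished restriction.** If the parabolic induction
`π = ∏_a π_a` is distinguished by the centralizer of a torus-normalizing `A` with `σ_A` an
involution, then there is a torus-normalizing `A'` with `σ_{A'}` an involution and induced
permutation `τ_{A'}` such that the exterior tensor product of the Jacquet restrictions
`⊠_a r_{T_{a,•}}(π_a)` (for the refined partition `T_{a,b} = {i ∈ T_a : f(τ_{A'} i) = b}`)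
has a nonzero vector invariant under the `σ_{A'}`-fixed elements of the refined Levi. -/
theorem statement5 (q : ℕ) (hq : IsPrimePow q) (hqodd : Odd q)
    (F : Type) [Field F] [Fintype F] (hF : Fintype.card F = q)
    (n m : ℕ) (A : GL (Fin n) F) (τA : Equiv.Perm (Fin n))
    (hAmono : IsMonomialWith A τA) (hAinv : A ^ 2 ∈ Subgroup.center (GL (Fin n) F))
    (k : Fin m → ℕ) (f : Fin n → Fin m) (e : ∀ a, Fin (k a) → Fin n)
    (he : ∀ a, StrictMono (e a)) (hmem : ∀ a i, f (e a i) = a)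
    (hsurj : ∀ a j, f j = a → ∃ i, e a i = j)
    (V : Fin m → Type) [∀ a, AddCommGroup (V a)] [∀ a, Module ℂ (V a)]
    [∀ a, FiniteDimensional ℂ (V a)]
    (π : ∀ a, Representation ℂ (GL (Fin (k a)) F) (V a))
    (hdist : HasInvVec
      (parabolicInd f e (fun a => (he a).injective) hmem hsurj π)
      (Subgroup.centralizer {A} : Set (GL (Fin n) F))) :
    ∃ (A' : GL (Fin n) F) (τ : Equiv.Perm (Fin n)),
      IsMonomialWith A' τ ∧ A' ^ 2 ∈ Subgroup.center (GL (Fin n) F) ∧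
      HasInvVec
        (jacquetTensorRep f e (fun a => (he a).injective) hmem hsurj π τ)
        {l : levi (F := F) (refinedF f τ) |
          A' * (l : GL (Fin n) F) * A'⁻¹ = (l : GL (Fin n) F)} := by
  have h2 : (2 : F) ≠ 0 := Ring.two_ne_zero fun h => by
    have := FiniteField.even_card_of_char_two h
    rw [hF] at this
    exact absurd (Nat.even_iff.mpr this) (Nat.not_even_iff_odd.mpr hqodd)
  obtain ⟨φ, hφ0, hφ⟩ := hdist
  obtain ⟨g, hg⟩ : ∃ g, φ.1 g ≠ 0 := by
    by_contra! h
    exact hφ0 (Subtype.ext (funext h))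
  have hconj : ∀ x : GL (Fin n) F,
      (x * A * x⁻¹) ^ 2 ∈ Subgroup.center (GL (Fin n) F) := fun x => by
    rw [conj_pow]
    exact Subgroup.Normal.conj_mem inferInstance _ hAinv x
  obtain ⟨Q, hQ, τ, hmono⟩ := exists_parabolic_conj_monomial h2 f (g * A * g⁻¹) (hconj g)
  have hA' : Q⁻¹ * (g * A * g⁻¹) * Q = (Q⁻¹ * g) * A * (Q⁻¹ * g)⁻¹ := by group
  rw [hA'] at hmono
  refine ⟨_, τ, hmono, hconj _, hasInvVec_jacquetTensorRep _ hmem hsurj π hmono (hconj _)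
    ⟨φ.1 (Q⁻¹ * g), fun h0 => hg ?_, fun p hp => ?_⟩⟩
  · have := φ.2 ⟨Q, hQ⟩ (Q⁻¹ * g)
    rw [h0, map_zero] at this
    simpa using this
  · set x := Q⁻¹ * g
    have hcent : x⁻¹ * p * x ∈ Subgroup.centralizer {A} := by
      rw [Subgroup.mem_centralizer_singleton_iff]
      have hp : x * A * x⁻¹ * p * (x * A * x⁻¹)⁻¹ = p := hp
      have hp : x * A * x⁻¹ * p = p * (x * A * x⁻¹) := mul_inv_eq_iff_eq_mul.mp hp
      calc x⁻¹ * p * x * A = x⁻¹ * (p * (x * A * x⁻¹)) * x := by group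
        _ = A * (x⁻¹ * p * x) := by rw [← hp]; group
    have h1 : φ.1 (x * (x⁻¹ * p * x)) = φ.1 x :=
      congrFun (congrArg Subtype.val (hφ _ hcent)) x
    rw [← φ.2 p x, ← h1]
    group

end Paper
end
end
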